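/- Let q ≡ 7 (mod 8) and r ≡ s ≡ 3 (mod 8) be three distinct primes with (q/r) = (q/s) = -1 and (s/r) = 1, and write ε_{2qrs} = a + b√(2qrs). Assume 2q(a-1) is not a perfect square. Then a fundamental system of units of the field K₁ = Q(√(2q), √(rs), √2) = Q(√2, √q, √(rs)) is {−1, ε₂, ε_{rs}, ε_{2qrs}, √ε_q, √ε_{2q}, √ε_{2rs}, √ε_{qrs}, √(ε_{rs}ε_{2qrs})} (as a generating set of the unit group), and the unit index q(K₁) = [E_{K₁} : ∏ E_{kᵢ}] over the seven quadratic subfields equals 2⁵. -/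

import Mathlib

open NumberField

/-- The subfield of ℝ generated over ℚ by a set of real numbers. -/
noncomputable def Qadj (S : Set ℝ) : IntermediateField ℚ ℝ := IntermediateField.adjoin ℚ S

/-- The real number associated to a unit of the ring of integers of a subfield `K` of ℝ. -/
noncomputable def unitVal (K : IntermediateField ℚ ℝ) (u : (𝓞 K)ˣ) : ℝ :=
  ((algebraMap (𝓞 K) K (u : 𝓞 K) : K) : ℝ)

/-- `u` is the fundamental unit of the subfield `F` of `K`: it lies in `F`, is `> 1`, and
is least among the units of `𝓞 K` lying in `F` that are `> 1`. -/
noncomputable def IsFundUnitIn (K F : IntermediateField ℚ ℝ) (u : (𝓞 K)ˣ) : Prop :=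
  unitVal K u ∈ F ∧ 1 < unitVal K u ∧
    ∀ v : (𝓞 K)ˣ, unitVal K v ∈ F → 1 < unitVal K v → unitVal K u ≤ unitVal K v

/-- The subgroup of the units of 𝓞_K generated by the units lying in the subfields in
`Fs` (the product of the unit groups of the subfields). -/
noncomputable def subfieldUnits (K : IntermediateField ℚ ℝ)
    (Fs : Set (IntermediateField ℚ ℝ)) : Subgroup (𝓞 K)ˣ :=
  Subgroup.closure {u : (𝓞 K)ˣ | ∃ F ∈ Fs, unitVal K u ∈ F}

section FieldPart
variable {L : Type*} [Field L] [Algebra ℚ L]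

/-- Elements of `ℚ(S, t)` with `t² ∈ ℚ` have the form `α + β t`. -/
theorem rep_adjoin_insert (S : Set L) (t : L) (m : ℚ) (ht : t ^ 2 = algebraMap ℚ L m) {x : L}
    (hx : x ∈ IntermediateField.adjoin ℚ (insert t S)) :
    ∃ α ∈ IntermediateField.adjoin ℚ S, ∃ β ∈ IntermediateField.adjoin ℚ S, x = α + β * t := by
  have hm : t ^ 2 ∈ IntermediateField.adjoin ℚ S := by
    rw [ht]; exact IntermediateField.algebraMap_mem _ _
  induction hx using IntermediateField.adjoin_induction with
  | mem x hx =>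
    rcases hx with rfl | hx
    · exact ⟨0, zero_mem _, 1, one_mem _, by ring⟩
    · exact ⟨x, IntermediateField.subset_adjoin _ _ hx, 0, zero_mem _, by ring⟩
  | algebraMap x => exact ⟨_, IntermediateField.algebraMap_mem _ x, 0, zero_mem _, by ring⟩
  | add x y _ _ hx hy =>
    obtain ⟨α, hα, β, hβ, rfl⟩ := hx
    obtain ⟨γ, hγ, δ, hδ, rfl⟩ := hy
    exact ⟨α + γ, add_mem hα hγ, β + δ, add_mem hβ hδ, by ring⟩
  | inv x _ hx =>
    obtain ⟨α, hα, β, hβ, rfl⟩ := hx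
    by_cases h0 : α + β * t = 0
    · exact ⟨0, zero_mem _, 0, zero_mem _, by rw [h0]; simp⟩
    by_cases h1 : α - β * t = 0
    · refine ⟨(2 * α)⁻¹, inv_mem (mul_mem (by simp) hα), 0, zero_mem _, ?_⟩
      have : β * t = α := by linear_combination -h1
      rw [this]; ring
    · refine ⟨α * (α ^ 2 - β ^ 2 * t ^ 2)⁻¹, mul_mem hα (inv_mem (sub_mem (pow_mem hα 2) (mul_mem (pow_mem hβ 2) hm))),
        -β * (α ^ 2 - β ^ 2 * t ^ 2)⁻¹, mul_mem (neg_mem hβ) (inv_mem (sub_mem (pow_mem hα 2) (mul_mem (pow_mem hβ 2) hm))), ?_⟩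
      have h2 : α ^ 2 - β ^ 2 * t ^ 2 = (α + β * t) * (α - β * t) := by ring
      rw [h2]
      field_simp
      ring
  | mul x y _ _ hx hy =>
    obtain ⟨α, hα, β, hβ, rfl⟩ := hx
    obtain ⟨γ, hγ, δ, hδ, rfl⟩ := hy
    exact ⟨α * γ + β * δ * t ^ 2, add_mem (mul_mem hα hγ) (mul_mem (mul_mem hβ hδ) hm),
      α * δ + β * γ, add_mem (mul_mem hα hδ) (mul_mem hβ hγ), by ring⟩

/-- Elements of `ℚ(t)` with `t² ∈ ℚ`. -/
theorem rep_adjoin_single (t : L) (m : ℚ) (ht : t ^ 2 = algebraMap ℚ L m) {x : L}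
    (hx : x ∈ IntermediateField.adjoin ℚ {t}) :
    ∃ α β : ℚ, x = algebraMap ℚ L α + algebraMap ℚ L β * t := by
  have hx' : x ∈ IntermediateField.adjoin ℚ (insert t (∅ : Set L)) := by simpa using hx
  obtain ⟨α, hα, β, hβ, rfl⟩ := rep_adjoin_insert ∅ t m ht hx'
  rw [IntermediateField.adjoin_empty, IntermediateField.mem_bot] at hα hβ
  obtain ⟨α, rfl⟩ := hα
  obtain ⟨β, rfl⟩ := hβ
  exact ⟨α, β, rfl⟩

/-- If a rational is a square in `ℚ(S, t)`, then up to a factor `t²` it is a square in `ℚ(S)`. -/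
theorem sq_descend [CharZero L] (S : Set L) (t : L) (m : ℚ) (ht : t ^ 2 = algebraMap ℚ L m) (k : ℚ)
    (h : ∃ z ∈ IntermediateField.adjoin ℚ (insert t S), z ^ 2 = algebraMap ℚ L k) :
    ∃ i : ℕ, ∃ z ∈ IntermediateField.adjoin ℚ S, z ^ 2 = algebraMap ℚ L (k * m ^ i) := by
  obtain ⟨z, hz, hzk⟩ := h
  obtain ⟨α, hα, β, hβ, rfl⟩ := rep_adjoin_insert S t m ht hz
  by_cases h : α * β = 0
  · rcases mul_eq_zero.1 h with h | h
    · refine ⟨1, β * algebraMap ℚ L m, mul_mem hβ (IntermediateField.algebraMap_mem _ _), ?_⟩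
      rw [pow_one, map_mul, ← hzk, h, ← ht]; ring
    · refine ⟨0, α, hα, ?_⟩
      rw [pow_zero, mul_one, ← hzk, h]; ring
  · refine ⟨0, α + β * t, ?_, by simpa using hzk⟩
    have h2 : t = (algebraMap ℚ L k - α ^ 2 - β ^ 2 * algebraMap ℚ L m) * (2 * (α * β))⁻¹ := by
      rw [← hzk, ← ht]
      have : α ≠ 0 := fun h' => h (by simp [h'])
      have : β ≠ 0 := fun h' => h (by simp [h'])
      field_simp
      ring
    have : t ∈ IntermediateField.adjoin ℚ S := by
      rw [h2]
      have h2m : (2 : L) ∈ IntermediateField.adjoin ℚ S := by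
        simp
      exact mul_mem (sub_mem (sub_mem (IntermediateField.algebraMap_mem _ _) (pow_mem hα 2))
        (mul_mem (pow_mem hβ 2) (IntermediateField.algebraMap_mem _ _)))
        (inv_mem (mul_mem h2m (mul_mem hα hβ)))
    exact add_mem hα (mul_mem hβ this)

theorem sqrt_prime_notMem [CharZero L] (p p1 p2 p3 : ℕ) (hp : p.Prime) (hp1 : p1.Prime) (hp2 : p2.Prime)
    (hp3 : p3.Prime) (n1 : p ≠ p1) (n2 : p ≠ p2) (n3 : p ≠ p3) (t t1 t2 t3 : L)
    (ht : t ^ 2 = p) (ht1 : t1 ^ 2 = p1) (ht2 : t2 ^ 2 = p2) (ht3 : t3 ^ 2 = p3) :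
    t ∉ IntermediateField.adjoin ℚ {t1, t2, t3} := by
  intro hmem
  have hq1 : (p1 : ℚ) ≠ 0 := by exact_mod_cast hp1.ne_zero
  have hq2 : (p2 : ℚ) ≠ 0 := by exact_mod_cast hp2.ne_zero
  have hq3 : (p3 : ℚ) ≠ 0 := by exact_mod_cast hp3.ne_zero
  have hq0 : (p : ℚ) ≠ 0 := by exact_mod_cast hp.ne_zero
  obtain ⟨i, h⟩ := sq_descend _ t1 p1 (by simpa using ht1) p ⟨t, hmem, by simpa using ht⟩
  obtain ⟨j, h⟩ := sq_descend _ t2 p2 (by simpa using ht2) _ h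
  have h' : ∃ z ∈ IntermediateField.adjoin ℚ (insert t3 (∅ : Set L)), z ^ 2 = algebraMap ℚ L (p * p1 ^ i * p2 ^ j) := by
    simpa using h
  obtain ⟨k, z, hz, h⟩ := sq_descend _ t3 p3 (by simpa using ht3) _ h'
  rw [IntermediateField.adjoin_empty, IntermediateField.mem_bot] at hz
  obtain ⟨y, rfl⟩ := hz
  rw [← map_pow] at h
  have h := (algebraMap ℚ L).injective h
  have := Fact.mk hp
  have := Fact.mk hp1
  have := Fact.mk hp2
  have := Fact.mk hp3
  have hy : y ≠ 0 := by
    rintro rfl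
    have : (p * p1 ^ i * p2 ^ j * p3 ^ k : ℚ) ≠ 0 := by positivity
    exact this (by rw [← h]; simp)
  have hv := congrArg (padicValRat p) h
  rw [padicValRat.pow _ , padicValRat.mul (by positivity) (by positivity), padicValRat.mul (by positivity) (by positivity),
    padicValRat.mul (by positivity) (by positivity), padicValRat.pow _, padicValRat.pow _, padicValRat.pow _,
    padicValRat.of_nat, padicValRat.of_nat, padicValRat.of_nat, padicValRat.of_nat,
    padicValNat_primes n1, padicValNat_primes n2, padicValNat_primes n3, padicValNat_self] at hv
  push_cast at hv
  omega

/-- Elements fixed by an involution flipping `t`. -/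
theorem mem_of_fixed [CharZero L] (S : Set L) (t : L) (m : ℚ) (ht : t ^ 2 = algebraMap ℚ L m) (σ : L ≃ₐ[ℚ] L)
    (hS : ∀ y ∈ S, σ y = y) (hσ : σ t = -t) {z : L}
    (hz : z ∈ IntermediateField.adjoin ℚ (insert t S)) (hfix : σ z = z) :
    z ∈ IntermediateField.adjoin ℚ S := by
  obtain ⟨α, hα, β, hβ, rfl⟩ := rep_adjoin_insert S t m ht hz
  have key : ∀ y ∈ IntermediateField.adjoin ℚ S, σ y = y := by
    intro y hy
    induction hy using IntermediateField.adjoin_induction with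
    | mem x hx => exact hS x hx
    | algebraMap x => exact σ.commutes x
    | add x y _ _ hx hy => rw [map_add, hx, hy]
    | inv x _ hx => rw [map_inv₀, hx]
    | mul x y _ _ hx hy => rw [map_mul, hx, hy]
  rw [map_add, map_mul, key α hα, key β hβ, hσ] at hfix
  have : 2 * (β * t) = 0 := by linear_combination -hfix
  have : β * t = 0 := by
    rcases mul_eq_zero.1 this with h | h
    · exact absurd h two_ne_zero
    · exact h
  rw [this, add_zero]; exact hα

theorem exists_flip [FiniteDimensional ℚ L] [IsGalois ℚ L] (S : Set L) (t : L) (m : ℚ) (ht : t ^ 2 = algebraMap ℚ L m)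
    (h : t ∉ IntermediateField.adjoin ℚ S) :
    ∃ σ : L ≃ₐ[ℚ] L, (∀ y ∈ S, σ y = y) ∧ σ t = -t := by
  by_contra hcon
  push Not at hcon
  apply h
  rw [← IsGalois.fixedField_fixingSubgroup (IntermediateField.adjoin ℚ S), IntermediateField.mem_fixedField_iff]
  intro f hf
  rw [IntermediateField.mem_fixingSubgroup_iff] at hf
  have h1 := hcon f (fun y hy => hf y (IntermediateField.subset_adjoin _ _ hy))
  have h2 : (f t) ^ 2 = t ^ 2 := by rw [← map_pow, ht, f.commutes]
  rcases sq_eq_sq_iff_eq_or_eq_neg.1 h2 with h3 | h3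
  · exact h3
  · exact absurd h3 h1

end FieldPart

/-- A multiquadratic field with its sign-changing automorphisms. -/
structure MQ (q r s : ℕ) (L : Type*) [Field L] [LinearOrder L] [IsStrictOrderedRing L] [Algebra ℚ L] where
  t2 : L
  tq : L
  tr : L
  ts : L
  t2_pos : 0 < t2
  tq_pos : 0 < tq
  tr_pos : 0 < tr
  ts_pos : 0 < ts
  t2_sq : t2 ^ 2 = 2
  tq_sq : tq ^ 2 = q
  tr_sq : tr ^ 2 = r
  ts_sq : ts ^ 2 = s
  a : L ≃ₐ[ℚ] L
  b : L ≃ₐ[ℚ] L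
  c : L ≃ₐ[ℚ] L
  e : L ≃ₐ[ℚ] L
  a_t2 : a t2 = -t2
  a_tq : a tq = tq
  a_tr : a tr = tr
  a_ts : a ts = ts
  b_t2 : b t2 = t2
  b_tq : b tq = -tq
  b_tr : b tr = tr
  b_ts : b ts = ts
  c_t2 : c t2 = t2
  c_tq : c tq = tq
  c_tr : c tr = -tr
  c_ts : c ts = ts
  e_t2 : e t2 = t2
  e_tq : e tq = tq
  e_tr : e tr = tr
  e_ts : e ts = -ts
  top : ∀ f g : L ≃ₐ[ℚ] L, f t2 = g t2 → f tq = g tq → f tr = g tr → f ts = g ts → f = g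

attribute [simp] MQ.a_t2 MQ.a_tq MQ.a_tr MQ.a_ts MQ.b_t2 MQ.b_tq MQ.b_tr MQ.b_ts
  MQ.c_t2 MQ.c_tq MQ.c_tr MQ.c_ts MQ.e_t2 MQ.e_tq MQ.e_tr MQ.e_ts

noncomputable def bigL (q r s : ℕ) : IntermediateField ℚ ℝ :=
  IntermediateField.adjoin ℚ {Real.sqrt 2, Real.sqrt q, Real.sqrt r, Real.sqrt s}

theorem exists_MQ (q r s : ℕ) (hq : q.Prime) (hr : r.Prime) (hs : s.Prime)
    (hqr : q ≠ r) (hqs : q ≠ s) (hrs : r ≠ s) (hq2 : q ≠ 2) (hr2 : r ≠ 2) (hs2 : s ≠ 2) :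
    ∃ M : MQ q r s (bigL q r s), (M.t2 : ℝ) = Real.sqrt 2 ∧ (M.tq : ℝ) = Real.sqrt q ∧
      (M.tr : ℝ) = Real.sqrt r ∧ (M.ts : ℝ) = Real.sqrt s := by
  have m2 : Real.sqrt 2 ∈ bigL q r s := IntermediateField.subset_adjoin _ _ (by simp)
  have mq : Real.sqrt q ∈ bigL q r s := IntermediateField.subset_adjoin _ _ (by simp)
  have mr : Real.sqrt r ∈ bigL q r s := IntermediateField.subset_adjoin _ _ (by simp)
  have ms : Real.sqrt s ∈ bigL q r s := IntermediateField.subset_adjoin _ _ (by simp)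
  have hIntg : ∀ n : ℕ, IsIntegral ℚ (Real.sqrt n) := by
    intro n
    refine IsIntegral.of_pow (n := 2) (by norm_num) ?_
    rw [Real.sq_sqrt (by positivity)]
    exact isIntegral_algebraMap (x := (n : ℚ)) |> fun h => by simpa using h
  have hset : ∀ x ∈ ({Real.sqrt 2, Real.sqrt q, Real.sqrt r, Real.sqrt s} : Set ℝ), ∃ n : ℕ, x = Real.sqrt n := by
    rintro x (rfl | rfl | rfl | rfl)
    · exact ⟨2, by simp⟩
    · exact ⟨q, rfl⟩
    · exact ⟨r, rfl⟩
    · exact ⟨s, rfl⟩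
  have hsplit : ∀ x ∈ ({Real.sqrt 2, Real.sqrt q, Real.sqrt r, Real.sqrt s} : Set ℝ),
      IsIntegral ℚ x ∧ ((minpoly ℚ x).map (algebraMap ℚ (bigL q r s))).Splits := by
    intro x hx
    have hxm : x ∈ bigL q r s := IntermediateField.subset_adjoin _ _ hx
    obtain ⟨n, rfl⟩ := hset x hx
    refine ⟨hIntg n, ?_⟩
    have hdvd : minpoly ℚ (Real.sqrt n) ∣ (Polynomial.X ^ 2 - Polynomial.C (n : ℚ)) := by
      apply minpoly.dvd
      simp
    have h2 : ((Polynomial.X ^ 2 - Polynomial.C (n : ℚ)).map (algebraMap ℚ (bigL q r s))) =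
        (Polynomial.X - Polynomial.C (⟨Real.sqrt n, hxm⟩ : bigL q r s)) *
        (Polynomial.X - Polynomial.C (-⟨Real.sqrt n, hxm⟩ : bigL q r s)) := by
      have h3 : (algebraMap ℚ (bigL q r s)) (n : ℚ) = (⟨Real.sqrt n, hxm⟩ : bigL q r s) ^ 2 := by
        apply Subtype.ext
        simp
      rw [Polynomial.map_sub, Polynomial.map_pow, Polynomial.map_X, Polynomial.map_C, h3]
      simp only [map_pow, map_neg]
      ring
    refine Polynomial.Splits.of_dvd ?_ ?_ (Polynomial.map_dvd _ hdvd)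
    · rw [h2]
      exact (Polynomial.Splits.X_sub_C _).mul (Polynomial.Splits.X_sub_C _)
    · rw [h2]
      exact mul_ne_zero (Polynomial.X_sub_C_ne_zero _) (Polynomial.X_sub_C_ne_zero _)
  have hfd : FiniteDimensional ℚ (bigL q r s) := by
    apply IntermediateField.finiteDimensional_adjoin
    intro x hx
    exact (hsplit x hx).1
  have hnorm : Normal ℚ (bigL q r s) := by
    rw [normal_iff]
    intro x
    refine ⟨Algebra.IsIntegral.isIntegral x, ?_⟩
    have := IntermediateField.splits_of_mem_adjoin _ _ hsplit x.2
    rwa [← minpoly.algebraMap_eq (algebraMap (bigL q r s) ℝ).injective x]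
  have : IsGalois ℚ (bigL q r s) := ⟨⟩
  have sq2 : (⟨_, m2⟩ : bigL q r s) ^ 2 = 2 := by
    apply Subtype.ext
    change (Real.sqrt 2) ^ 2 = 2
    simp
  have sq2' : (⟨_, m2⟩ : bigL q r s) ^ 2 = (2 : ℕ) := by rw [sq2]; norm_num
  have sqq : (⟨_, mq⟩ : bigL q r s) ^ 2 = q := by apply Subtype.ext; simp
  have sqr : (⟨_, mr⟩ : bigL q r s) ^ 2 = r := by apply Subtype.ext; simp
  have sqs : (⟨_, ms⟩ : bigL q r s) ^ 2 = s := by apply Subtype.ext; simp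
  obtain ⟨a, ha, ha'⟩ := exists_flip _ _ 2 (sq2.trans (map_ofNat _ 2).symm)
    (sqrt_prime_notMem 2 q r s Nat.prime_two hq hr hs hq2.symm hr2.symm hs2.symm _ _ _ _ sq2' sqq sqr sqs)
  obtain ⟨b, hb, hb'⟩ := exists_flip _ _ q (by simpa using sqq)
    (sqrt_prime_notMem q 2 r s hq Nat.prime_two hr hs hq2 hqr hqs _ _ _ _ sqq sq2' sqr sqs)
  obtain ⟨c, hc, hc'⟩ := exists_flip _ _ r (by simpa using sqr)
    (sqrt_prime_notMem r 2 q s hr Nat.prime_two hq hs hr2 hqr.symm hrs _ _ _ _ sqr sq2' sqq sqs)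
  obtain ⟨e, he, he'⟩ := exists_flip _ _ s (by simpa using sqs)
    (sqrt_prime_notMem s 2 q r hs Nat.prime_two hq hr hs2 hqs.symm hrs.symm _ _ _ _ sqs sq2' sqq sqr)
  have p2 : 0 < Real.sqrt 2 := by positivity
  have pq : 0 < Real.sqrt q := Real.sqrt_pos.2 (by exact_mod_cast hq.pos)
  have pr : 0 < Real.sqrt r := Real.sqrt_pos.2 (by exact_mod_cast hr.pos)
  have ps : 0 < Real.sqrt s := Real.sqrt_pos.2 (by exact_mod_cast hs.pos)
  refine ⟨⟨⟨_, m2⟩, ⟨_, mq⟩, ⟨_, mr⟩, ⟨_, ms⟩, p2, pq, pr, ps, sq2, sqq, sqr, sqs, a, b, c, e,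
    ha', ha _ (by simp), ha _ (by simp), ha _ (by simp),
    hb _ (by simp), hb', hb _ (by simp), hb _ (by simp),
    hc _ (by simp), hc _ (by simp), hc', hc _ (by simp),
    he _ (by simp), he _ (by simp), he _ (by simp), he', ?_⟩, rfl, rfl, rfl, rfl⟩
  intro f g f2 fq fr fs
  have : (f : bigL q r s →ₐ[ℚ] bigL q r s) = g := by
    apply IntermediateField.algHom_ext_of_eq_adjoin (S := bigL q r s) ℚ rfl
    rintro x (rfl | rfl | rfl | rfl)
    · exact f2
    · exact fq
    · exact fr
    · exact fs
  ext x
  exact congrArg Subtype.val (DFunLike.congr_fun this x)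


/-- Fundamental solution of the Pell equation. -/
def PFund (d : ℕ) (x y : ℤ) : Prop :=
  1 < x ∧ 0 < y ∧ x ^ 2 - d * y ^ 2 = 1 ∧
    ∀ x' y' : ℤ, 0 < x' → 0 < y' → x' ^ 2 - d * y' ^ 2 = 1 → x ≤ x'

theorem exists_PFund (d : ℕ) (h0 : 0 < d) (h : ¬ IsSquare d) : ∃ x y : ℤ, PFund d x y := by
  obtain ⟨a, ha⟩ := Pell.IsFundamental.exists_of_not_isSquare (d := (d : ℤ)) (by exact_mod_cast h0)
    (by rwa [Int.isSquare_natCast_iff])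
  refine ⟨a.x, a.y, ha.1, ha.2.1, a.prop, ?_⟩
  intro x' y' hx hy hxy
  have := ha.2.2 (show 1 < (Pell.Solution₁.mk x' y' hxy).x by
    simp only [Pell.Solution₁.x_mk]
    have : 0 < (d : ℤ) * y' ^ 2 := by positivity
    nlinarith)
  simpa using this

theorem split_prime (p P Q m n m' n' k : ℕ) (hp : p.Prime) (hm : m = P * m') (hn : n = Q * n')
    (hc : Nat.Coprime m' n') (h : m' * n' = p * k) :
    (∃ m'', m = (P * p) * m'' ∧ n = Q * n' ∧ Nat.Coprime m'' n' ∧ m'' * n' = k) ∨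
    (∃ n'', m = P * m' ∧ n = (Q * p) * n'' ∧ Nat.Coprime m' n'' ∧ m' * n'' = k) := by
  have hd : p ∣ m' * n' := ⟨k, h⟩
  rcases (Nat.Prime.dvd_mul hp).1 hd with ⟨w, rfl⟩ | ⟨w, rfl⟩
  · left
    refine ⟨w, by rw [hm]; ring, hn, Nat.Coprime.coprime_mul_left hc, ?_⟩
    apply Nat.eq_of_mul_eq_mul_left hp.pos
    rw [← h]; ring
  · right
    refine ⟨w, hm, by rw [hn]; ring, Nat.Coprime.coprime_mul_left_right hc, ?_⟩
    apply Nat.eq_of_mul_eq_mul_left hp.pos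
    rw [← h]; ring

theorem split_end (m n Y : ℕ) (hc : Nat.Coprime m n) (h : m * n = Y ^ 2) :
    ∃ u v : ℕ, m = u ^ 2 ∧ n = v ^ 2 ∧ Y = u * v := by
  have key : ∀ m n : ℕ, Nat.Coprime m n → m * n = Y ^ 2 → ∃ u, m = u ^ 2 := by
    intro m n hc h
    obtain ⟨a0, h0⟩ := Int.sq_of_gcd_eq_one (a := (m : ℤ)) (b := n) (c := Y) (by simpa using hc) (by exact_mod_cast h)
    refine ⟨a0.natAbs, ?_⟩
    rcases h0 with h0 | h0
    · zify; simpa using h0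
    · have : (0 : ℤ) ≤ m := by positivity
      have h1 : a0 ^ 2 = 0 := by nlinarith [sq_nonneg a0]
      zify; simp; omega
  obtain ⟨u, hu⟩ := key m n hc h
  obtain ⟨v, hv⟩ := key n m hc.symm (by rw [mul_comm]; exact h)
  refine ⟨u, v, hu, hv, ?_⟩
  rw [hu, hv, ← mul_pow] at h
  exact (Nat.pow_left_injective (by norm_num : (2:ℕ) ≠ 0) h).symm

theorem kill1 (p : ℕ) [Fact p.Prime] {P Q c u v : ℕ} (h : P * u ^ 2 = Q * v ^ 2 + c)
    (h0 : legendreSym p (Q : ℕ) = 0) (h1 : legendreSym p ((P * c : ℕ) : ℤ) = -1) : False := by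
  rw [legendreSym.eq_neg_one_iff] at h1
  rw [legendreSym.eq_zero_iff] at h0
  apply h1
  refine ⟨(P : ZMod p) * u, ?_⟩
  have h2 := congrArg (Nat.cast : ℕ → ZMod p) h
  push_cast at h2 h0 ⊢
  linear_combination (-(P : ZMod p)) * h2 - (P : ZMod p) * (v : ZMod p) ^ 2 * h0

theorem kill2 (p : ℕ) [Fact p.Prime] {P Q c u v : ℕ} (h : P * u ^ 2 = Q * v ^ 2 + c)
    (h0 : legendreSym p (P : ℕ) = 0) (h1 : legendreSym p (-1 * ((Q * c : ℕ) : ℤ)) = -1) : False := by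
  rw [legendreSym.eq_neg_one_iff] at h1
  rw [legendreSym.eq_zero_iff] at h0
  apply h1
  refine ⟨(Q : ZMod p) * v, ?_⟩
  have h2 := congrArg (Nat.cast : ℕ → ZMod p) h
  push_cast at h2 h0 ⊢
  linear_combination ((Q : ZMod p)) * h2 - (Q : ZMod p) * (u : ZMod p) ^ 2 * h0

theorem odd_case (d : ℕ) (hd : d % 4 ≠ 0) (x y : ℤ) (h : PFund d x y) (hx : x % 2 = 1) :
    ∃ n Y : ℕ, x = 2 * n + 1 ∧ y = 2 * Y ∧ (n + 1) * n = d * Y ^ 2 ∧ Nat.Coprime (n + 1) n ∧ 0 < n ∧ 0 < Y := by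
  obtain ⟨h1, h2, h3, -⟩ := h
  have hy : y % 2 = 0 := by
    by_contra hy
    obtain ⟨k, rfl⟩ : ∃ k, x = 2 * k + 1 := ⟨x / 2, by omega⟩
    obtain ⟨l, rfl⟩ : ∃ l, y = 2 * l + 1 := ⟨y / 2, by omega⟩
    have : (d : ℤ) = 4 * (k ^ 2 + k - d * l ^ 2 - d * l) := by linear_combination -h3
    omega
  obtain ⟨n, rfl⟩ : ∃ n : ℕ, x = 2 * n + 1 := ⟨(x / 2).toNat, by omega⟩
  obtain ⟨Y, rfl⟩ : ∃ Y : ℕ, y = 2 * Y := ⟨(y / 2).toNat, by omega⟩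
  refine ⟨n, Y, rfl, rfl, ?_, by simp, by omega, by omega⟩
  zify
  linarith

theorem even_case (d : ℕ) (x y : ℤ) (h : PFund d x y) (hx : x % 2 = 0) :
    ∃ n Y : ℕ, x = n + 1 ∧ y = Y ∧ (n + 2) * n = d * Y ^ 2 ∧ Nat.Coprime (n + 2) n ∧ 0 < n ∧ 0 < Y := by
  obtain ⟨h1, h2, h3, -⟩ := h
  obtain ⟨n, rfl⟩ : ∃ n : ℕ, x = n + 1 := ⟨(x - 1).toNat, by omega⟩
  obtain ⟨Y, rfl⟩ : ∃ Y : ℕ, y = Y := ⟨y.toNat, by omega⟩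
  refine ⟨n, Y, rfl, rfl, ?_, ?_, by omega, by omega⟩
  · zify
    linear_combination h3
  · rw [add_comm, Nat.coprime_add_self_left]
    exact Nat.coprime_two_left.2 (Nat.odd_iff.2 (by omega))

/-- the trivial factorisation contradicts minimality -/
theorem kill_min (d : ℕ) (x y : ℤ) (h : PFund d x y) (n u v : ℕ) (hx : x = 2 * n + 1)
    (hn : 0 < n) (hv : 0 < v) (h1 : n + 1 = u ^ 2) (h2 : u ^ 2 = d * v ^ 2 + 1) : False := by
  obtain ⟨-, -, -, h4⟩ := h
  have hu : 0 < u := by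
    rcases Nat.eq_zero_or_pos u with rfl | h
    · simp at h1
    · exact h
  have := h4 u v (by exact_mod_cast hu) (by exact_mod_cast hv) (by
    have : (u : ℤ) ^ 2 = d * v ^ 2 + 1 := by exact_mod_cast h2
    linarith)
  have h5 : (n : ℤ) + 1 = u ^ 2 := by exact_mod_cast h1
  have : (0 : ℤ) < u := by exact_mod_cast hu
  nlinarith

/-- the Legendre symbols -/
structure LS (q r s : ℕ) [Fact q.Prime] [Fact r.Prime] [Fact s.Prime] : Prop where
  r2 : legendreSym r 2 = -1
  rq : legendreSym r q = -1
  rs : legendreSym r s = 1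
  rr : legendreSym r r = 0
  rm : legendreSym r (-1) = -1
  s2 : legendreSym s 2 = -1
  sq : legendreSym s q = -1
  sr : legendreSym s r = -1
  ss : legendreSym s s = 0
  sm : legendreSym s (-1) = -1
  q2 : legendreSym q 2 = 1
  qr : legendreSym q r = 1
  qs : legendreSym q s = 1
  qq : legendreSym q q = 0
  qm : legendreSym q (-1) = -1

theorem LS_of (q r s : ℕ) [Fact q.Prime] [Fact r.Prime] [Fact s.Prime]
    (hq8 : q % 8 = 7) (hr8 : r % 8 = 3) (hs8 : s % 8 = 3)
    (h1 : legendreSym r (q : ℤ) = -1) (h2 : legendreSym s (q : ℤ) = -1)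
    (h3 : legendreSym r (s : ℤ) = 1) : LS q r s := by
  have two3 : ∀ p : ℕ, [Fact p.Prime] → p % 8 = 3 → legendreSym p 2 = -1 := by
    intro p _ hp
    rw [legendreSym.at_two (by omega), ZMod.χ₈_nat_eq_if_mod_eight]
    have : p % 2 = 1 := by omega
    simp [hp, this]
  have neg3 : ∀ p : ℕ, [Fact p.Prime] → p % 4 = 3 → legendreSym p (-1) = -1 := by
    intro p _ hp
    rw [legendreSym.at_neg_one (by omega), ZMod.χ₄_nat_three_mod_four hp]
  have self0 : ∀ p : ℕ, [Fact p.Prime] → legendreSym p p = 0 := by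
    intro p _
    rw [legendreSym.eq_zero_iff]; simp
  refine ⟨two3 r hr8, h1, h3, self0 r, neg3 r (by omega), two3 s hs8, h2, ?_, self0 s, neg3 s (by omega), ?_, ?_, ?_,
    self0 q, neg3 q (by omega)⟩
  · rw [legendreSym.quadratic_reciprocity_three_mod_four (by omega) (by omega), h3]
  · rw [legendreSym.at_two (by omega), ZMod.χ₈_nat_eq_if_mod_eight]
    have : q % 2 = 1 := by omega
    simp [hq8, this]
  · rw [legendreSym.quadratic_reciprocity_three_mod_four (by omega) (by omega), h1]; rfl
  · rw [legendreSym.quadratic_reciprocity_three_mod_four (by omega) (by omega), h2]; rfl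

theorem pos_of_mul_eq {Y u v : ℕ} (hY : 0 < Y) (h : Y = u * v) : 0 < u ∧ 0 < v := by
  constructor
  · rcases Nat.eq_zero_or_pos u with rfl | h' <;> [simp_all; exact h']
  · rcases Nat.eq_zero_or_pos v with rfl | h' <;> [simp_all; exact h']

/-- one leaf of the case analysis -/
theorem leaf_bad (q r s : ℕ) [Fact q.Prime] [Fact r.Prime] [Fact s.Prime] (P Q c : ℕ)
    {u v : ℕ} (heq : P * u ^ 2 = Q * v ^ 2 + c)
    (h : (legendreSym r (Q : ℕ) = 0 ∧ legendreSym r ((P * c : ℕ) : ℤ) = -1) ∨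
      (legendreSym r (P : ℕ) = 0 ∧ legendreSym r (-1) * legendreSym r ((Q * c : ℕ) : ℤ) = -1) ∨
      (legendreSym s (Q : ℕ) = 0 ∧ legendreSym s ((P * c : ℕ) : ℤ) = -1) ∨
      (legendreSym s (P : ℕ) = 0 ∧ legendreSym s (-1) * legendreSym s ((Q * c : ℕ) : ℤ) = -1) ∨
      (legendreSym q (Q : ℕ) = 0 ∧ legendreSym q ((P * c : ℕ) : ℤ) = -1) ∨
      (legendreSym q (P : ℕ) = 0 ∧ legendreSym q (-1) * legendreSym q ((Q * c : ℕ) : ℤ) = -1)) : False := by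
  rcases h with ⟨h0, h1⟩ | ⟨h0, h1⟩ | ⟨h0, h1⟩ | ⟨h0, h1⟩ | ⟨h0, h1⟩ | ⟨h0, h1⟩
  · exact kill1 r heq h0 h1
  · exact kill2 r heq h0 (by rw [legendreSym.mul]; exact h1)
  · exact kill1 s heq h0 h1
  · exact kill2 s heq h0 (by rw [legendreSym.mul]; exact h1)
  · exact kill1 q heq h0 h1
  · exact kill2 q heq h0 (by rw [legendreSym.mul]; exact h1)

theorem nt_q (q r s : ℕ) [hq : Fact q.Prime] [hr : Fact r.Prime] [hs : Fact s.Prime] (H : LS q r s) (hq8 : q % 8 = 7) (hr8 : r % 8 = 3) (hs8 : s % 8 = 3) (x y : ℤ) (h : PFund q x y) :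
    ∃ u v : ℕ, 0 < u ∧ 0 < v ∧ 2 * x = 1 * u ^ 2 + q * v ^ 2 ∧ y = u * v ∧ (1 * u ^ 2 : ℤ) = q * v ^ 2 + 2 := by
  rcases Int.emod_two_eq_zero_or_one x with hx | hx
  · obtain ⟨n, Y, hxn, hyY, hmn, hc, hn0, hY0⟩ := even_case _ x y h hx
    rcases split_prime q 1 1 _ _ _ _ _ hq.out (one_mul _).symm (one_mul _).symm hc hmn with ⟨_, hm, hn, hc, hk⟩ | ⟨_, hm, hn, hc, hk⟩ <;>
    obtain ⟨u, v, hu', hv', hY⟩ := split_end _ _ _ hc hk <;>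
    replace hm := hm.trans (congrArg (HMul.hMul _) hu') <;>
    replace hn := hn.trans (congrArg (HMul.hMul _) hv') <;>
    obtain ⟨hu, hv⟩ := pos_of_mul_eq hY0 hY <;>
    have heq := hm.symm.trans (congrArg (fun z => z + 2) hn) <;>
    first | (exfalso; refine leaf_bad q r s _ _ _ heq ?_; simp [legendreSym.mul, legendreSym.at_one, H.r2, H.rq, H.rs, H.rr, H.rm, H.s2, H.sq, H.sr, H.ss, H.sm, H.q2, H.qr, H.qs, H.qq, H.qm]; done) | skip
    · refine ⟨u, v, hu, hv, ?_, ?_, ?_⟩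
      · rw [hxn]; zify at hm hn; linear_combination hm + hn
      · rw [hyY, hY]; push_cast; ring
      · zify at heq; linear_combination heq
  · obtain ⟨n, Y, hxn, hyY, hmn, hc, hn0, hY0⟩ := odd_case _ (by omega) x y h hx
    rcases split_prime q 1 1 _ _ _ _ _ hq.out (one_mul _).symm (one_mul _).symm hc hmn with ⟨_, hm, hn, hc, hk⟩ | ⟨_, hm, hn, hc, hk⟩ <;>
    obtain ⟨u, v, hu', hv', hY⟩ := split_end _ _ _ hc hk <;>
    replace hm := hm.trans (congrArg (HMul.hMul _) hu') <;>
    replace hn := hn.trans (congrArg (HMul.hMul _) hv') <;>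
    obtain ⟨hu, hv⟩ := pos_of_mul_eq hY0 hY <;>
    have heq := hm.symm.trans (congrArg (fun z => z + 1) hn) <;>
    first | (exfalso; refine leaf_bad q r s _ _ _ heq ?_; simp [legendreSym.mul, legendreSym.at_one, H.r2, H.rq, H.rs, H.rr, H.rm, H.s2, H.sq, H.sr, H.ss, H.sm, H.q2, H.qr, H.qs, H.qq, H.qm]; done) | skip
    · exact (kill_min _ x y h n u v hxn hn0 hv (by linarith) (by linarith)).elim

theorem nt_2q (q r s : ℕ) [hq : Fact q.Prime] [hr : Fact r.Prime] [hs : Fact s.Prime] (H : LS q r s) (hq8 : q % 8 = 7) (hr8 : r % 8 = 3) (hs8 : s % 8 = 3) (x y : ℤ) (h : PFund (2 * q) x y) :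
    ∃ u v : ℕ, 0 < u ∧ 0 < v ∧ x = 2 * u ^ 2 + q * v ^ 2 ∧ y = 2 * u * v ∧ (2 * u ^ 2 : ℤ) = q * v ^ 2 + 1 := by
  have hx : x % 2 = 1 := by
    obtain ⟨-, -, h3, -⟩ := h
    push_cast at h3
    rcases Int.emod_two_eq_zero_or_one x with hx | hx
    · obtain ⟨k, rfl⟩ : ∃ k, x = 2 * k := ⟨x / 2, by omega⟩
      have : 2 * (2 * k ^ 2 - q * y ^ 2) = 1 := by linear_combination h3
      omega
    · exact hx
  · obtain ⟨n, Y, hxn, hyY, hmn, hc, hn0, hY0⟩ := odd_case _ (by omega) x y h hx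
    simp only [mul_assoc] at hmn
    rcases split_prime 2 1 1 _ _ _ _ _ Nat.prime_two (one_mul _).symm (one_mul _).symm hc hmn with ⟨_, hm, hn, hc, hk⟩ | ⟨_, hm, hn, hc, hk⟩ <;>
    rcases split_prime q _ _ _ _ _ _ _ hq.out hm hn hc hk with ⟨_, hm, hn, hc, hk⟩ | ⟨_, hm, hn, hc, hk⟩ <;>
    obtain ⟨u, v, hu', hv', hY⟩ := split_end _ _ _ hc hk <;>
    replace hm := hm.trans (congrArg (HMul.hMul _) hu') <;>
    replace hn := hn.trans (congrArg (HMul.hMul _) hv') <;>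
    obtain ⟨hu, hv⟩ := pos_of_mul_eq hY0 hY <;>
    have heq := hm.symm.trans (congrArg (fun z => z + 1) hn) <;>
    first | (exfalso; refine leaf_bad q r s _ _ _ heq ?_; simp [legendreSym.mul, legendreSym.at_one, H.r2, H.rq, H.rs, H.rr, H.rm, H.s2, H.sq, H.sr, H.ss, H.sm, H.q2, H.qr, H.qs, H.qq, H.qm]; done) | skip
    · refine ⟨u, v, hu, hv, ?_, ?_, ?_⟩
      · rw [hxn]; zify at hm hn; linear_combination hm + hn
      · rw [hyY, hY]; push_cast; ring
      · zify at heq; linear_combination heq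
    · exact (kill_min _ x y h n u v hxn hn0 hv (by linarith) (by linarith)).elim

theorem nt_rs (q r s : ℕ) [hq : Fact q.Prime] [hr : Fact r.Prime] [hs : Fact s.Prime] (H : LS q r s) (hq8 : q % 8 = 7) (hr8 : r % 8 = 3) (hs8 : s % 8 = 3) (x y : ℤ) (h : PFund (r * s) x y) :
    ∃ u v : ℕ, 0 < u ∧ 0 < v ∧ x = s * u ^ 2 + r * v ^ 2 ∧ y = 2 * u * v ∧ (s * u ^ 2 : ℤ) = r * v ^ 2 + 1 := by
  have hrs8 : (r * s) % 8 = 1 := by rw [Nat.mul_mod, hr8, hs8]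
  have hx : x % 2 = 1 := by
    obtain ⟨-, -, h3, -⟩ := h
    rcases Int.emod_two_eq_zero_or_one x with hx | hx
    · exfalso
      obtain ⟨k, rfl⟩ : ∃ k, x = 2 * k := ⟨x / 2, by omega⟩
      obtain ⟨m, hm⟩ : ∃ m : ℕ, r * s = 8 * m + 1 := ⟨(r * s) / 8, by omega⟩
      rw [hm] at h3
      push_cast at h3
      have h4 : y ^ 2 = 4 * (k ^ 2 - 2 * m * y ^ 2) - 1 := by linear_combination -h3
      rcases Int.emod_two_eq_zero_or_one y with hy | hy
      · obtain ⟨l, rfl⟩ : ∃ k, y = 2 * k := ⟨y / 2, by omega⟩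
        ring_nf at h4; omega
      · obtain ⟨l, rfl⟩ : ∃ k, y = 2 * k + 1 := ⟨y / 2, by omega⟩
        ring_nf at h4; omega
    · exact hx
  · obtain ⟨n, Y, hxn, hyY, hmn, hc, hn0, hY0⟩ := odd_case _ (by omega) x y h hx
    simp only [mul_assoc] at hmn
    rcases split_prime r 1 1 _ _ _ _ _ hr.out (one_mul _).symm (one_mul _).symm hc hmn with ⟨_, hm, hn, hc, hk⟩ | ⟨_, hm, hn, hc, hk⟩ <;>
    rcases split_prime s _ _ _ _ _ _ _ hs.out hm hn hc hk with ⟨_, hm, hn, hc, hk⟩ | ⟨_, hm, hn, hc, hk⟩ <;>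
    obtain ⟨u, v, hu', hv', hY⟩ := split_end _ _ _ hc hk <;>
    replace hm := hm.trans (congrArg (HMul.hMul _) hu') <;>
    replace hn := hn.trans (congrArg (HMul.hMul _) hv') <;>
    obtain ⟨hu, hv⟩ := pos_of_mul_eq hY0 hY <;>
    have heq := hm.symm.trans (congrArg (fun z => z + 1) hn) <;>
    first | (exfalso; refine leaf_bad q r s _ _ _ heq ?_; simp [legendreSym.mul, legendreSym.at_one, H.r2, H.rq, H.rs, H.rr, H.rm, H.s2, H.sq, H.sr, H.ss, H.sm, H.q2, H.qr, H.qs, H.qq, H.qm]; done) | skip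
    · refine ⟨u, v, hu, hv, ?_, ?_, ?_⟩
      · rw [hxn]; zify at hm hn; linear_combination hm + hn
      · rw [hyY, hY]; push_cast; ring
      · zify at heq; linear_combination heq
    · exact (kill_min _ x y h n u v hxn hn0 hv (by linarith) (by linarith)).elim

theorem nt_2rs (q r s : ℕ) [hq : Fact q.Prime] [hr : Fact r.Prime] [hs : Fact s.Prime] (H : LS q r s) (hq8 : q % 8 = 7) (hr8 : r % 8 = 3) (hs8 : s % 8 = 3) (x y : ℤ) (h : PFund (2 * (r * s)) x y) :
    ∃ u v : ℕ, 0 < u ∧ 0 < v ∧ x = (r * s) * u ^ 2 + 2 * v ^ 2 ∧ y = 2 * u * v ∧ ((r * s) * u ^ 2 : ℤ) = 2 * v ^ 2 + 1 := by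
  have hrs8 : (r * s) % 8 = 1 := by rw [Nat.mul_mod, hr8, hs8]
  have hx : x % 2 = 1 := by
    obtain ⟨-, -, h3, -⟩ := h
    push_cast at h3
    rcases Int.emod_two_eq_zero_or_one x with hx | hx
    · obtain ⟨k, rfl⟩ : ∃ k, x = 2 * k := ⟨x / 2, by omega⟩
      have : 2 * (2 * k ^ 2 - (r * s) * y ^ 2) = 1 := by linear_combination h3
      omega
    · exact hx
  · obtain ⟨n, Y, hxn, hyY, hmn, hc, hn0, hY0⟩ := odd_case _ (by omega) x y h hx
    simp only [mul_assoc] at hmn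
    rcases split_prime 2 1 1 _ _ _ _ _ Nat.prime_two (one_mul _).symm (one_mul _).symm hc hmn with ⟨_, hm, hn, hc, hk⟩ | ⟨_, hm, hn, hc, hk⟩ <;>
    rcases split_prime r _ _ _ _ _ _ _ hr.out hm hn hc hk with ⟨_, hm, hn, hc, hk⟩ | ⟨_, hm, hn, hc, hk⟩ <;>
    rcases split_prime s _ _ _ _ _ _ _ hs.out hm hn hc hk with ⟨_, hm, hn, hc, hk⟩ | ⟨_, hm, hn, hc, hk⟩ <;>
    obtain ⟨u, v, hu', hv', hY⟩ := split_end _ _ _ hc hk <;>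
    replace hm := hm.trans (congrArg (HMul.hMul _) hu') <;>
    replace hn := hn.trans (congrArg (HMul.hMul _) hv') <;>
    obtain ⟨hu, hv⟩ := pos_of_mul_eq hY0 hY <;>
    have heq := hm.symm.trans (congrArg (fun z => z + 1) hn) <;>
    first | (exfalso; refine leaf_bad q r s _ _ _ heq ?_; simp [legendreSym.mul, legendreSym.at_one, H.r2, H.rq, H.rs, H.rr, H.rm, H.s2, H.sq, H.sr, H.ss, H.sm, H.q2, H.qr, H.qs, H.qq, H.qm]; done) | skip
    · refine ⟨u, v, hu, hv, ?_, ?_, ?_⟩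
      · rw [hxn]; zify at hm hn; linear_combination hm + hn
      · rw [hyY, hY]; push_cast; ring
      · zify at heq; linear_combination heq
    · exact (kill_min _ x y h n u v hxn hn0 hv (by linarith) (by linarith)).elim

theorem nt_qrs (q r s : ℕ) [hq : Fact q.Prime] [hr : Fact r.Prime] [hs : Fact s.Prime] (H : LS q r s) (hq8 : q % 8 = 7) (hr8 : r % 8 = 3) (hs8 : s % 8 = 3) (x y : ℤ) (h : PFund (q * (r * s)) x y) :
    ∃ u v : ℕ, 0 < u ∧ 0 < v ∧ x = (r * s) * u ^ 2 + q * v ^ 2 ∧ y = 2 * u * v ∧ ((r * s) * u ^ 2 : ℤ) = q * v ^ 2 + 1 := by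
  have hrs8 : (q * (r * s)) % 8 = 7 := by simp [Nat.mul_mod, hq8, hr8, hs8]
  rcases Int.emod_two_eq_zero_or_one x with hx | hx
  · obtain ⟨n, Y, hxn, hyY, hmn, hc, hn0, hY0⟩ := even_case _ x y h hx
    simp only [mul_assoc] at hmn
    rcases split_prime q 1 1 _ _ _ _ _ hq.out (one_mul _).symm (one_mul _).symm hc hmn with ⟨_, hm, hn, hc, hk⟩ | ⟨_, hm, hn, hc, hk⟩ <;>
    rcases split_prime r _ _ _ _ _ _ _ hr.out hm hn hc hk with ⟨_, hm, hn, hc, hk⟩ | ⟨_, hm, hn, hc, hk⟩ <;>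
    rcases split_prime s _ _ _ _ _ _ _ hs.out hm hn hc hk with ⟨_, hm, hn, hc, hk⟩ | ⟨_, hm, hn, hc, hk⟩ <;>
    obtain ⟨u, v, hu', hv', hY⟩ := split_end _ _ _ hc hk <;>
    replace hm := hm.trans (congrArg (HMul.hMul _) hu') <;>
    replace hn := hn.trans (congrArg (HMul.hMul _) hv') <;>
    obtain ⟨hu, hv⟩ := pos_of_mul_eq hY0 hY <;>
    have heq := hm.symm.trans (congrArg (fun z => z + 2) hn) <;>
    first | (exfalso; refine leaf_bad q r s _ _ _ heq ?_; simp [legendreSym.mul, legendreSym.at_one, H.r2, H.rq, H.rs, H.rr, H.rm, H.s2, H.sq, H.sr, H.ss, H.sm, H.q2, H.qr, H.qs, H.qq, H.qm]; done) | skip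
  · obtain ⟨n, Y, hxn, hyY, hmn, hc, hn0, hY0⟩ := odd_case _ (by omega) x y h hx
    simp only [mul_assoc] at hmn
    rcases split_prime q 1 1 _ _ _ _ _ hq.out (one_mul _).symm (one_mul _).symm hc hmn with ⟨_, hm, hn, hc, hk⟩ | ⟨_, hm, hn, hc, hk⟩ <;>
    rcases split_prime r _ _ _ _ _ _ _ hr.out hm hn hc hk with ⟨_, hm, hn, hc, hk⟩ | ⟨_, hm, hn, hc, hk⟩ <;>
    rcases split_prime s _ _ _ _ _ _ _ hs.out hm hn hc hk with ⟨_, hm, hn, hc, hk⟩ | ⟨_, hm, hn, hc, hk⟩ <;>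
    obtain ⟨u, v, hu', hv', hY⟩ := split_end _ _ _ hc hk <;>
    replace hm := hm.trans (congrArg (HMul.hMul _) hu') <;>
    replace hn := hn.trans (congrArg (HMul.hMul _) hv') <;>
    obtain ⟨hu, hv⟩ := pos_of_mul_eq hY0 hY <;>
    have heq := hm.symm.trans (congrArg (fun z => z + 1) hn) <;>
    first | (exfalso; refine leaf_bad q r s _ _ _ heq ?_; simp [legendreSym.mul, legendreSym.at_one, H.r2, H.rq, H.rs, H.rr, H.rm, H.s2, H.sq, H.sr, H.ss, H.sm, H.q2, H.qr, H.qs, H.qq, H.qm]; done) | skip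
    · refine ⟨u, v, hu, hv, ?_, ?_, ?_⟩
      · rw [hxn]; zify at hm hn; linear_combination hm + hn
      · rw [hyY, hY]; push_cast; ring
      · zify at heq; linear_combination heq
    · exact (kill_min _ x y h n u v hxn hn0 hv (by linarith) (by linarith)).elim

theorem nt_2qrs (q r s : ℕ) [hq : Fact q.Prime] [hr : Fact r.Prime] [hs : Fact s.Prime] (H : LS q r s) (hq8 : q % 8 = 7) (hr8 : r % 8 = 3) (hs8 : s % 8 = 3) (x y : ℤ) (h : PFund (2 * (q * (r * s))) x y)
    (hns : ¬ IsSquare (2 * q * (x - 1))) :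
    (∃ u v : ℕ, 0 < u ∧ 0 < v ∧ x = s * u ^ 2 + (2 * q * r) * v ^ 2 ∧ y = 2 * u * v ∧ (s * u ^ 2 : ℤ) = (2 * q * r) * v ^ 2 + 1) ∨
    (∃ u v : ℕ, 0 < u ∧ 0 < v ∧ x = (2 * r) * u ^ 2 + (q * s) * v ^ 2 ∧ y = 2 * u * v ∧ ((2 * r) * u ^ 2 : ℤ) = (q * s) * v ^ 2 + 1) := by
  have hrs8 : (q * (r * s)) % 8 = 7 := by simp [Nat.mul_mod, hq8, hr8, hs8]
  have hx : x % 2 = 1 := by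
    obtain ⟨-, -, h3, -⟩ := h
    push_cast at h3
    rcases Int.emod_two_eq_zero_or_one x with hx | hx
    · obtain ⟨k, rfl⟩ : ∃ k, x = 2 * k := ⟨x / 2, by omega⟩
      have : 2 * (2 * k ^ 2 - (q * (r * s)) * y ^ 2) = 1 := by linear_combination h3
      omega
    · exact hx
  · obtain ⟨n, Y, hxn, hyY, hmn, hc, hn0, hY0⟩ := odd_case _ (by omega) x y h hx
    simp only [mul_assoc] at hmn
    rcases split_prime 2 1 1 _ _ _ _ _ Nat.prime_two (one_mul _).symm (one_mul _).symm hc hmn with ⟨_, hm, hn, hc, hk⟩ | ⟨_, hm, hn, hc, hk⟩ <;>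
    rcases split_prime q _ _ _ _ _ _ _ hq.out hm hn hc hk with ⟨_, hm, hn, hc, hk⟩ | ⟨_, hm, hn, hc, hk⟩ <;>
    rcases split_prime r _ _ _ _ _ _ _ hr.out hm hn hc hk with ⟨_, hm, hn, hc, hk⟩ | ⟨_, hm, hn, hc, hk⟩ <;>
    rcases split_prime s _ _ _ _ _ _ _ hs.out hm hn hc hk with ⟨_, hm, hn, hc, hk⟩ | ⟨_, hm, hn, hc, hk⟩ <;>
    obtain ⟨u, v, hu', hv', hY⟩ := split_end _ _ _ hc hk <;>
    replace hm := hm.trans (congrArg (HMul.hMul _) hu') <;>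
    replace hn := hn.trans (congrArg (HMul.hMul _) hv') <;>
    obtain ⟨hu, hv⟩ := pos_of_mul_eq hY0 hY <;>
    have heq := hm.symm.trans (congrArg (fun z => z + 1) hn) <;>
    first | (exfalso; refine leaf_bad q r s _ _ _ heq ?_; simp [legendreSym.mul, legendreSym.at_one, H.r2, H.rq, H.rs, H.rr, H.rm, H.s2, H.sq, H.sr, H.ss, H.sm, H.q2, H.qr, H.qs, H.qq, H.qm]; done) | skip

    · exfalso
      apply hns
      refine ⟨2 * q * v, ?_⟩
      rw [hxn]; zify at hm hn; linear_combination 4 * q * hn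
    · right
      · refine ⟨u, v, hu, hv, ?_, ?_, ?_⟩
        · rw [hxn]; zify at hm hn; linear_combination hm + hn
        · rw [hyY, hY]; push_cast; ring
        · zify at heq; linear_combination heq
    · left
      · refine ⟨u, v, hu, hv, ?_, ?_, ?_⟩
        · rw [hxn]; zify at hm hn; linear_combination hm + hn
        · rw [hyY, hY]; push_cast; ring
        · zify at heq; linear_combination heq
    · exact (kill_min _ x y h n u v hxn hn0 hv (by linarith) (by linarith)).elim

set_option linter.unusedSectionVars false

section Abstract
variable {q r s : ℕ} {L : Type*} [Field L] [LinearOrder L] [IsStrictOrderedRing L] [Algebra ℚ L]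

theorem MQ.aa (M : MQ q r s L) (x : L) : M.a (M.a x) = x :=
  DFunLike.congr_fun (M.top (M.a.trans M.a) AlgEquiv.refl (by simp) (by simp) (by simp) (by simp)) x
theorem MQ.bb (M : MQ q r s L) (x : L) : M.b (M.b x) = x :=
  DFunLike.congr_fun (M.top (M.b.trans M.b) AlgEquiv.refl (by simp) (by simp) (by simp) (by simp)) x
theorem MQ.cc (M : MQ q r s L) (x : L) : M.c (M.c x) = x :=
  DFunLike.congr_fun (M.top (M.c.trans M.c) AlgEquiv.refl (by simp) (by simp) (by simp) (by simp)) x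
theorem MQ.ee (M : MQ q r s L) (x : L) : M.e (M.e x) = x :=
  DFunLike.congr_fun (M.top (M.e.trans M.e) AlgEquiv.refl (by simp) (by simp) (by simp) (by simp)) x
theorem MQ.ba (M : MQ q r s L) (x : L) : M.b (M.a x) = M.a (M.b x) :=
  DFunLike.congr_fun (M.top (M.a.trans M.b) (M.b.trans M.a) (by simp) (by simp) (by simp) (by simp)) x
theorem MQ.ca (M : MQ q r s L) (x : L) : M.c (M.a x) = M.a (M.c x) :=
  DFunLike.congr_fun (M.top (M.a.trans M.c) (M.c.trans M.a) (by simp) (by simp) (by simp) (by simp)) x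
theorem MQ.ea (M : MQ q r s L) (x : L) : M.e (M.a x) = M.a (M.e x) :=
  DFunLike.congr_fun (M.top (M.a.trans M.e) (M.e.trans M.a) (by simp) (by simp) (by simp) (by simp)) x
theorem MQ.cb (M : MQ q r s L) (x : L) : M.c (M.b x) = M.b (M.c x) :=
  DFunLike.congr_fun (M.top (M.b.trans M.c) (M.c.trans M.b) (by simp) (by simp) (by simp) (by simp)) x
theorem MQ.eb (M : MQ q r s L) (x : L) : M.e (M.b x) = M.b (M.e x) :=
  DFunLike.congr_fun (M.top (M.b.trans M.e) (M.e.trans M.b) (by simp) (by simp) (by simp) (by simp)) x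
theorem MQ.ec (M : MQ q r s L) (x : L) : M.e (M.c x) = M.c (M.e x) :=
  DFunLike.congr_fun (M.top (M.c.trans M.e) (M.e.trans M.c) (by simp) (by simp) (by simp) (by simp)) x

/-- The system of square roots of the fundamental units. -/
structure XS (M : MQ q r s L) where
  E : L
  X1 : L
  X2 : L
  X3 : L
  X4 : L
  X5 : L
  X6 : L
  d : L
  E_pos : 0 < E
  X1_pos : 0 < X1
  X2_pos : 0 < X2
  X3_pos : 0 < X3
  X4_pos : 0 < X4
  X5_pos : 0 < X5
  X6_pos : 0 < X6
  d_eq : d = 1 ∨ d = -1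
  aE : M.a E = -E⁻¹
  bE : M.b E = E
  cE : M.c E = E
  eE : M.e E = E
  aX1 : M.a X1 = -X1
  bX1 : M.b X1 = X1⁻¹
  cX1 : M.c X1 = X1
  eX1 : M.e X1 = X1
  aX2 : M.a X2 = -X2⁻¹
  bX2 : M.b X2 = X2⁻¹
  cX2 : M.c X2 = X2
  eX2 : M.e X2 = X2
  aX3 : M.a X3 = X3
  bX3 : M.b X3 = X3
  cX3 : M.c X3 = X3⁻¹
  eX3 : M.e X3 = -X3⁻¹
  aX4 : M.a X4 = X4⁻¹
  bX4 : M.b X4 = X4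
  cX4 : M.c X4 = -X4⁻¹
  eX4 : M.e X4 = -X4⁻¹
  aX5 : M.a X5 = X5
  bX5 : M.b X5 = X5⁻¹
  cX5 : M.c X5 = -X5⁻¹
  eX5 : M.e X5 = -X5⁻¹
  aX6 : M.a X6 = d * X6⁻¹
  bX6 : M.b X6 = X6⁻¹
  cX6 : M.c X6 = d * X6⁻¹
  eX6 : M.e X6 = -(d * X6⁻¹)

theorem sign_zpow (n : ℤ) : ((-1 : L) ^ n = 1 ∧ Even n) ∨ ((-1 : L) ^ n = -1 ∧ Odd n) := by
  rcases Int.even_or_odd n with h | h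
  · exact Or.inl ⟨h.neg_one_zpow, h⟩
  · exact Or.inr ⟨h.neg_one_zpow, h⟩

theorem fix_even {w Q : L} (τ : L ≃ₐ[ℚ] L) (n : ℤ) (h : w ^ 2 = Q ^ 2) (hQ : Q ≠ 0) (hw : τ w = w)
    (hτ : τ Q = (-1) ^ n * Q) : Even n := by
  rcases sign_zpow (L := L) n with ⟨-, h1⟩ | ⟨h1, -⟩
  · exact h1
  · exfalso
    rw [h1] at hτ
    rcases sq_eq_sq_iff_eq_or_eq_neg.1 h with rfl | rfl
    · rw [hw] at hτ
      apply hQ; linarith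
    · rw [map_neg, hτ] at hw
      apply hQ; linarith

theorem pos_even {x Q : L} (n : ℤ) (hQ : 0 < Q) (h : x ^ 2 = (-1) ^ n * Q) : Even n := by
  rcases sign_zpow (L := L) n with ⟨-, h1⟩ | ⟨h1, -⟩
  · exact h1
  · exfalso
    rw [h1] at h
    nlinarith [sq_nonneg x]

theorem neg_zpow_sign (x : L) (n : ℤ) : (-x) ^ n = (-1) ^ n * x ^ n := by
  rw [neg_eq_neg_one_mul, mul_zpow]

variable {M : MQ q r s L}

theorem XS.d_even (X : XS M) {n : ℤ} (h : Even n) : X.d ^ n = 1 := by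
  rcases X.d_eq with h1 | h1 <;> rw [h1]
  · simp
  · exact h.neg_one_zpow

theorem XS.dd (X : XS M) : X.d * X.d = 1 := by
  rcases X.d_eq with h1 | h1 <;> rw [h1] <;> norm_num

theorem XS.d_inv (X : XS M) : X.d⁻¹ = X.d := by
  rcases X.d_eq with h1 | h1 <;> rw [h1] <;> norm_num

/-- general monomial -/
def XS.P (X : XS M) (k n1 n2 n3 n4 n5 n6 : ℤ) : L :=
  X.E ^ k * X.X1 ^ n1 * X.X2 ^ n2 * X.X3 ^ n3 * X.X4 ^ n4 * X.X5 ^ n5 * X.X6 ^ n6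

theorem XS.P_pos (X : XS M) (k n1 n2 n3 n4 n5 n6 : ℤ) : 0 < X.P k n1 n2 n3 n4 n5 n6 := by
  have := X.E_pos; have := X.X1_pos; have := X.X2_pos; have := X.X3_pos
  have := X.X4_pos; have := X.X5_pos; have := X.X6_pos
  unfold XS.P; positivity

theorem XS.P_mul (X : XS M) (k n1 n2 n3 n4 n5 n6 k' n1' n2' n3' n4' n5' n6' : ℤ) :
    X.P k n1 n2 n3 n4 n5 n6 * X.P k' n1' n2' n3' n4' n5' n6' =
    X.P (k + k') (n1 + n1') (n2 + n2') (n3 + n3') (n4 + n4') (n5 + n5') (n6 + n6') := by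
  unfold XS.P
  rw [zpow_add₀ X.E_pos.ne', zpow_add₀ X.X1_pos.ne', zpow_add₀ X.X2_pos.ne', zpow_add₀ X.X3_pos.ne',
    zpow_add₀ X.X4_pos.ne', zpow_add₀ X.X5_pos.ne', zpow_add₀ X.X6_pos.ne']
  ring

theorem XS.P_sq (X : XS M) (k n1 n2 n3 n4 n5 n6 : ℤ) :
    X.P k n1 n2 n3 n4 n5 n6 ^ 2 =
    X.P (2 * k) (2 * n1) (2 * n2) (2 * n3) (2 * n4) (2 * n5) (2 * n6) := by
  rw [sq, P_mul]; simp only [two_mul]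

theorem XS.aP (X : XS M) (k n1 n2 n3 n4 n5 n6 : ℤ) : M.a (X.P k n1 n2 n3 n4 n5 n6) =
    (-1) ^ (k + n1 + n2) * X.d ^ n6 * X.P (-k) n1 (-n2) n3 (-n4) n5 (-n6) := by
  have h1 : (-1 : L) ≠ 0 := by norm_num
  simp only [XS.P, map_mul, map_zpow₀, X.aE, X.aX1, X.aX2, X.aX3, X.aX4, X.aX5, X.aX6, mul_zpow, zpow_neg,
    inv_zpow, zpow_add₀ h1, neg_zpow_sign X.E⁻¹, neg_zpow_sign X.X1, neg_zpow_sign X.X2⁻¹]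
  ring

theorem XS.bP (X : XS M) (k n1 n2 n3 n4 n5 n6 : ℤ) : M.b (X.P k n1 n2 n3 n4 n5 n6) =
    X.P k (-n1) (-n2) n3 n4 (-n5) (-n6) := by
  simp only [XS.P, map_mul, map_zpow₀, X.bE, X.bX1, X.bX2, X.bX3, X.bX4, X.bX5, X.bX6, zpow_neg,
    inv_zpow]

theorem XS.cP (X : XS M) (k n1 n2 n3 n4 n5 n6 : ℤ) : M.c (X.P k n1 n2 n3 n4 n5 n6) =
    (-1) ^ (n4 + n5) * X.d ^ n6 * X.P k n1 n2 (-n3) (-n4) (-n5) (-n6) := by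
  have h1 : (-1 : L) ≠ 0 := by norm_num
  simp only [XS.P, map_mul, map_zpow₀, X.cE, X.cX1, X.cX2, X.cX3, X.cX4, X.cX5, X.cX6, mul_zpow, zpow_neg,
    inv_zpow, zpow_add₀ h1, neg_zpow_sign X.X4⁻¹, neg_zpow_sign X.X5⁻¹]
  ring

theorem XS.eP (X : XS M) (k n1 n2 n3 n4 n5 n6 : ℤ) : M.e (X.P k n1 n2 n3 n4 n5 n6) =
    (-1) ^ (n3 + n4 + n5 + n6) * X.d ^ n6 * X.P k n1 n2 (-n3) (-n4) (-n5) (-n6) := by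
  have h1 : (-1 : L) ≠ 0 := by norm_num
  simp only [XS.P, map_mul, map_zpow₀, X.eE, X.eX1, X.eX2, X.eX3, X.eX4, X.eX5, X.eX6, mul_zpow, zpow_neg,
    inv_zpow, zpow_add₀ h1, neg_zpow_sign X.X3⁻¹, neg_zpow_sign X.X4⁻¹, neg_zpow_sign X.X5⁻¹, neg_zpow_sign (X.d * X.X6⁻¹)]
  ring

theorem neg_one_zpow_inv (n : ℤ) : ((-1 : L) ^ n)⁻¹ = (-1) ^ n := by
  rw [← inv_zpow]; norm_num

theorem neg_one_zpow_sq (n : ℤ) : (-1 : L) ^ n * (-1) ^ n = 1 := by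
  rw [← mul_zpow]; norm_num

theorem XS.kP (X : XS M) (k n1 n2 n3 n4 n5 n6 : ℤ) : M.c (M.e (X.P k n1 n2 n3 n4 n5 n6)) =
    (-1) ^ (n3 + n6) * X.P k n1 n2 n3 n4 n5 n6 := by
  have h1 : (-1 : L) ≠ 0 := by norm_num
  have hd : M.c X.d = X.d := by rcases X.d_eq with h | h <;> rw [h] <;> simp
  have h2 : X.d ^ n6 * X.d ^ (-n6) = 1 := by
    rw [← zpow_add₀ (by rcases X.d_eq with h | h <;> rw [h] <;> norm_num)]; simp
  rw [X.eP, map_mul, map_mul, map_zpow₀, map_zpow₀, hd, X.cP]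
  simp only [map_neg, map_one, neg_neg]
  rw [show -n4 + -n5 = -(n4 + n5) by ring, zpow_neg (-1 : L), neg_one_zpow_inv,
    show n3 + n4 + n5 + n6 = (n3 + n6) + (n4 + n5) by ring, zpow_add₀ h1 (n3 + n6)]
  linear_combination (-1 : L) ^ (n3 + n6) * X.P k n1 n2 n3 n4 n5 n6 * ((X.d ^ n6 * X.d ^ (-n6)) * neg_one_zpow_sq (L := L) (n4 + n5) + h2)

theorem XS.parity (X : XS M) (v : L) (hv : M.c (M.e v) = v) (k n1 n2 n3 n4 n5 n6 : ℤ)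
    (h : v ^ 2 = X.P k n1 n2 n3 n4 n5 n6) :
    ∃ k' m1 m2 m3 m4 m5 m6 : ℤ, k = 2 * k' ∧ n1 = 2 * m1 ∧ n2 = 2 * m2 ∧ n3 = 2 * m3 ∧
      n4 = 2 * m4 ∧ n5 = 2 * m5 ∧ n6 = 2 * m6 ∧ Even (m3 + m6) ∧
      (v = X.P k' m1 m2 m3 m4 m5 m6 ∨ v = - X.P k' m1 m2 m3 m4 m5 m6) := by
  -- κ
  have e36 : Even (n3 + n6) := by
    refine pos_even (x := v) _ (X.P_pos k n1 n2 n3 n4 n5 n6) ?_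
    rw [← X.kP, ← h, map_pow, map_pow, hv]
  have kb : M.c (M.e (M.b v)) = M.b v := by rw [M.eb, M.cb, hv]
  have ka : M.c (M.e (M.a v)) = M.a v := by rw [M.ea, M.ca, hv]
  have hb : (M.b v) ^ 2 = X.P k (-n1) (-n2) n3 n4 (-n5) (-n6) := by rw [← X.bP, ← h, map_pow]
  have e3 : Even n3 := by
    refine fix_even (w := v * M.b v) (Q := X.P k 0 0 n3 n4 0 0) (M.e.trans M.c) n3 ?_ (X.P_pos _ _ _ _ _ _ _).ne' ?_ ?_
    · rw [mul_pow, h, hb, X.P_mul, X.P_sq]; congr 1 <;> ring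
    · change M.c (M.e (v * M.b v)) = _
      rw [map_mul, map_mul, kb, hv]
    · change M.c (M.e _) = _
      rw [X.kP]; simp
  have e6 : Even n6 := (Int.even_add.1 e36).1 e3
  have d6 := X.d_even e6
  have ha : (M.a v) ^ 2 = (-1) ^ (k + n1 + n2) * X.P (-k) n1 (-n2) n3 (-n4) n5 (-n6) := by
    rw [← map_pow, h, X.aP, d6, mul_one]
  have e12 : Even (k + n1 + n2) := pos_even _ (X.P_pos _ _ _ _ _ _ _) ha
  rw [e12.neg_one_zpow, one_mul] at ha
  have e1 : Even n1 := by
    refine fix_even (w := v * M.a v) (Q := X.P 0 n1 0 n3 0 n5 0) M.a n1 ?_ (X.P_pos _ _ _ _ _ _ _).ne' ?_ ?_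
    · rw [mul_pow, h, ha, X.P_mul, X.P_sq]; congr 1 <;> ring
    · rw [map_mul, M.aa, mul_comm]
    · rw [X.aP]; simp
  have hc : (M.c v) ^ 2 = (-1) ^ (n4 + n5) * X.P k n1 n2 (-n3) (-n4) (-n5) (-n6) := by
    rw [← map_pow, h, X.cP, d6, mul_one]
  have e45 : Even (n4 + n5) := pos_even _ (X.P_pos _ _ _ _ _ _ _) hc
  rw [e45.neg_one_zpow, one_mul] at hc
  have hab : (M.a (M.b v)) ^ 2 = X.P (-k) (-n1) (n2) n3 (-n4) (-n5) (n6) := by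
    have e12' : Even (k + -n1 + -n2) := by
      have : k + -n1 + -n2 = (k + n1 + n2) + 2 * (-n1 - n2) := by ring
      rw [this]; exact e12.add (even_two_mul _)
    rw [← map_pow, hb, X.aP, e12'.neg_one_zpow, X.d_even e6.neg]; simp
  have e2 : Even n2 := by
    refine fix_even (w := v * M.a (M.b v)) (Q := X.P 0 0 n2 n3 0 0 n6) (M.b.trans M.a) n2 ?_ (X.P_pos _ _ _ _ _ _ _).ne' ?_ ?_
    · rw [mul_pow, h, hab, X.P_mul, X.P_sq]; congr 1 <;> ring
    · change M.a (M.b _) = _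
      rw [map_mul, map_mul, M.ba, M.bb, M.aa, mul_comm]
    · change M.a (M.b _) = _
      rw [X.bP, X.aP, X.d_even e6.neg]; simp [neg_one_zpow_inv]
  have e0 : Even k := by
    have := (Int.even_add.1 e12).2 e2
    exact (Int.even_add.1 this).2 e1
  have hbc : (M.b (M.c v)) ^ 2 = X.P k (-n1) (-n2) (-n3) (-n4) n5 n6 := by
    rw [← map_pow, hc, X.bP]; simp
  have e5 : Even n5 := by
    refine fix_even (w := v * M.b (M.c v)) (Q := X.P k 0 0 0 0 n5 n6) (M.c.trans M.b) n5 ?_ (X.P_pos _ _ _ _ _ _ _).ne' ?_ ?_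
    · rw [mul_pow, h, hbc, X.P_mul, X.P_sq]; congr 1 <;> ring
    · change M.b (M.c _) = _
      rw [map_mul, map_mul, M.cb, M.cc, M.bb, mul_comm]
    · change M.b (M.c _) = _
      rw [X.cP, d6, map_mul, X.bP]; simp
  have e4 : Even n4 := (Int.even_add.1 e45).2 e5
  obtain ⟨k', rfl⟩ := even_iff_exists_two_mul.1 e0
  obtain ⟨m1, rfl⟩ := even_iff_exists_two_mul.1 e1
  obtain ⟨m2, rfl⟩ := even_iff_exists_two_mul.1 e2
  obtain ⟨m3, rfl⟩ := even_iff_exists_two_mul.1 e3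
  obtain ⟨m4, rfl⟩ := even_iff_exists_two_mul.1 e4
  obtain ⟨m5, rfl⟩ := even_iff_exists_two_mul.1 e5
  obtain ⟨m6, rfl⟩ := even_iff_exists_two_mul.1 e6
  rw [← X.P_sq] at h
  refine ⟨k', m1, m2, m3, m4, m5, m6, rfl, rfl, rfl, rfl, rfl, rfl, rfl, ?_, sq_eq_sq_iff_eq_or_eq_neg.1 h⟩
  refine fix_even (w := v) (M.e.trans M.c) _ h (X.P_pos _ _ _ _ _ _ _).ne' hv ?_
  exact X.kP _ _ _ _ _ _ _
end Abstract

set_option linter.unusedSectionVars false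

section Quad
variable {L : Type*} [Field L] [LinearOrder L] [IsStrictOrderedRing L] [Algebra ℚ L]

/-- algebraic units -/
def IsU (v : L) : Prop := v ≠ 0 ∧ IsIntegral ℤ v ∧ IsIntegral ℤ v⁻¹

theorem IsU.mul {v w : L} (hv : IsU v) (hw : IsU w) : IsU (v * w) :=
  ⟨mul_ne_zero hv.1 hw.1, hv.2.1.mul hw.2.1, by rw [mul_inv]; exact hv.2.2.mul hw.2.2⟩

theorem IsU.one : IsU (1 : L) := ⟨one_ne_zero, isIntegral_one, by rw [inv_one]; exact isIntegral_one⟩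

theorem IsU.neg {v : L} (hv : IsU v) : IsU (-v) :=
  ⟨neg_ne_zero.2 hv.1, hv.2.1.neg, by rw [inv_neg]; exact hv.2.2.neg⟩

theorem IsU.inv {v : L} (hv : IsU v) : IsU v⁻¹ :=
  ⟨inv_ne_zero hv.1, hv.2.2, by rw [inv_inv]; exact hv.2.1⟩

theorem IsU.pow {v : L} (hv : IsU v) (n : ℕ) : IsU (v ^ n) :=
  ⟨pow_ne_zero n hv.1, hv.2.1.pow n, by rw [← inv_pow]; exact hv.2.2.pow n⟩

theorem IsU.zpow {v : L} (hv : IsU v) (n : ℤ) : IsU (v ^ n) := by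
  cases n with
  | ofNat n => simpa using hv.pow n
  | negSucc n => rw [zpow_negSucc]; exact (hv.pow _).inv

theorem IsU.map {v : L} (hv : IsU v) (σ : L ≃ₐ[ℚ] L) : IsU (σ v) := by
  have key : ∀ x : L, IsIntegral ℤ x → IsIntegral ℤ (σ x) := fun x hx =>
    hx.map (σ : L ≃+* L).toRingHom.toIntAlgHom
  exact ⟨by simpa using hv.1, key _ hv.2.1, by rw [← map_inv₀]; exact key _ hv.2.2⟩

theorem rat_int (x : ℚ) (h : IsIntegral ℤ (algebraMap ℚ L x)) : ∃ n : ℤ, x = n := by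
  have h' : IsIntegral ℤ x := (isIntegral_algebraMap_iff (algebraMap ℚ L).injective).1 h
  obtain ⟨n, hn⟩ := IsIntegrallyClosed.isIntegral_iff.1 h'
  exact ⟨n, by simpa using hn.symm⟩

theorem sqfree_int (d : ℕ) (hd : Squarefree d) (x : ℚ) (n : ℤ) (h : d * x ^ 2 = n) : ∃ m : ℤ, x = m := by
  have h0 : (x.den : ℤ) * x.den ∣ d := by
    have hx : x = x.num / x.den := (Rat.num_div_den x).symm
    have hden : (x.den : ℚ) ≠ 0 := by exact_mod_cast x.den_nz
    rw [hx] at h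
    field_simp at h
    have h2 : (d : ℤ) * x.num ^ 2 = n * x.den ^ 2 := by
      have : ((d * x.num ^ 2 : ℤ) : ℚ) = ((n * x.den ^ 2 : ℤ) : ℚ) := by push_cast; linarith
      exact_mod_cast this
    have hcop : IsCoprime ((x.den : ℤ) * x.den) (x.num ^ 2) := by
      have : IsCoprime (x.den : ℤ) x.num := by
        rw [Int.isCoprime_iff_nat_coprime]; simpa using x.reduced.symm
      exact (this.pow_right).mul_left this.pow_right
    exact hcop.dvd_of_dvd_mul_right ⟨n, by rw [h2]; ring⟩
  have h1 : x.den * x.den ∣ d := by exact_mod_cast h0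
  have := hd _ h1
  rw [Nat.isUnit_iff] at this
  exact ⟨x.num, ((Rat.den_eq_one_iff x).1 this).symm⟩

theorem quad_parity (A B : ℤ) (d : ℕ) (hd : d % 8 = 1 ∨ d % 8 = 2 ∨ d % 8 = 3 ∨ d % 8 = 6 ∨ d % 8 = 7)
    (h : A ^ 2 - d * B ^ 2 = 4 ∨ A ^ 2 - d * B ^ 2 = -4) : 2 ∣ A ∧ 2 ∣ B := by
  have key : ∀ A B d : ZMod 8, (d = 1 ∨ d = 2 ∨ d = 3 ∨ d = 6 ∨ d = 7) →
    (A ^ 2 - d * B ^ 2 = 4) → 4 * A = 0 ∧ 4 * B = 0 := by decide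
  have hdz : ((d : ZMod 8) = 1 ∨ (d : ZMod 8) = 2 ∨ (d : ZMod 8) = 3 ∨ (d : ZMod 8) = 6 ∨ (d : ZMod 8) = 7) := by
    have : ((d % 8 : ℕ) : ZMod 8) = (d : ZMod 8) := ZMod.natCast_mod d 8
    rcases hd with h | h | h | h | h <;> rw [h] at this <;> simp [← this]
  have hz : ((A : ZMod 8)) ^ 2 - d * (B : ZMod 8) ^ 2 = 4 := by
    rcases h with h | h
    · have := congrArg (Int.cast : ℤ → ZMod 8) h
      push_cast at this; exact this
    · have := congrArg (Int.cast : ℤ → ZMod 8) h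
      push_cast at this; rw [this]; decide
  have := key A B d hdz hz
  have h4 : ∀ C : ℤ, 4 * (C : ZMod 8) = 0 → 2 ∣ C := by
    intro C hC
    have : ((4 * C : ℤ) : ZMod 8) = 0 := by push_cast; exact hC
    have := (ZMod.intCast_zmod_eq_zero_iff_dvd _ 8).1 this
    push_cast at this
    omega
  exact ⟨h4 _ this.1, h4 _ this.2⟩

theorem quad_rep (d : ℕ) (hsq : Squarefree d)
    (hd : d % 8 = 1 ∨ d % 8 = 2 ∨ d % 8 = 3 ∨ d % 8 = 6 ∨ d % 8 = 7)
    (t : L) (ht : t ^ 2 = d) (σ : L ≃ₐ[ℚ] L) (hσ : σ t = -t) {v : L} (hv : IsU v)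
    (hmem : v ∈ IntermediateField.adjoin ℚ {t}) :
    ∃ x y : ℤ, v = x + y * t ∧ (x ^ 2 - d * y ^ 2 = 1 ∨ x ^ 2 - d * y ^ 2 = -1) := by
  obtain ⟨α, β, rfl⟩ := rep_adjoin_single t d (by simpa using ht) hmem
  have hs : σ (algebraMap ℚ L α + algebraMap ℚ L β * t) = algebraMap ℚ L α - algebraMap ℚ L β * t := by
    rw [map_add, map_mul, σ.commutes, σ.commutes, hσ]; ring
  have hv' := hv.map σ
  rw [hs] at hv'
  have h1 : IsIntegral ℤ (algebraMap ℚ L (2 * α)) := by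
    have h2 : algebraMap ℚ L (2 * α) = (algebraMap ℚ L α + algebraMap ℚ L β * t) +
        (algebraMap ℚ L α - algebraMap ℚ L β * t) := by
      rw [map_mul, map_ofNat]; ring
    rw [h2]
    exact hv.2.1.add hv'.2.1
  have hN : algebraMap ℚ L (α ^ 2 - d * β ^ 2) = (algebraMap ℚ L α + algebraMap ℚ L β * t) * (algebraMap ℚ L α - algebraMap ℚ L β * t) := by
    rw [map_sub, map_mul, map_pow, map_pow, map_natCast]
    linear_combination (algebraMap ℚ L β) ^ 2 * ht
  have hU := hv.mul hv'
  rw [← hN] at hU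
  obtain ⟨A, hA⟩ := rat_int _ h1
  obtain ⟨n, hn⟩ := rat_int _ hU.2.1
  obtain ⟨n', hn'⟩ := rat_int (L := L) ((α ^ 2 - d * β ^ 2)⁻¹) (by rw [map_inv₀]; exact hU.2.2)
  have hne : (α ^ 2 - d * β ^ 2) ≠ 0 := by
    intro h; apply hU.1; rw [h, map_zero]
  have hnn : n * n' = 1 := by
    have : (n : ℚ) * n' = 1 := by rw [← hn, ← hn']; exact mul_inv_cancel₀ hne
    exact_mod_cast this
  have hn1 : n = 1 ∨ n = -1 := Int.isUnit_iff.1 (IsUnit.of_mul_eq_one _ hnn)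
  have h4 : (d : ℚ) * (2 * β) ^ 2 = ((A ^ 2 - 4 * n : ℤ) : ℚ) := by
    push_cast; rw [← hA, ← hn]; ring
  obtain ⟨B, hB⟩ := sqfree_int d hsq _ _ h4
  have hAB : A ^ 2 - d * B ^ 2 = 4 * n := by
    have : (A : ℚ) ^ 2 - d * B ^ 2 = 4 * n := by rw [← hA, ← hB, ← hn]; ring
    exact_mod_cast this
  obtain ⟨⟨x, rfl⟩, ⟨y, rfl⟩⟩ := quad_parity A B d hd (by rcases hn1 with rfl | rfl <;> [left; right] <;> linarith)
  refine ⟨x, y, ?_, ?_⟩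
  · have hx : α = x := by push_cast at hA; linarith
    have hy : β = y := by push_cast at hB; linarith
    rw [hx, hy]; simp
  · have : x ^ 2 - d * y ^ 2 = n := by linarith
    rw [this]; exact hn1

theorem no_neg_one (p d : ℕ) (hp : p.Prime) (hp4 : p % 4 = 3) (hpd : p ∣ d) (x y : ℤ)
    (h : x ^ 2 - d * y ^ 2 = -1) : False := by
  have : Fact p.Prime := ⟨hp⟩
  refine (ZMod.exists_sq_eq_neg_one_iff (p := p)).1 ?_ hp4
  have h1 := congrArg (Int.cast : ℤ → ZMod p) h
  push_cast at h1
  rw [(ZMod.natCast_eq_zero_iff d p).2 hpd] at h1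
  exact ⟨x, by rw [← h1]; ring⟩

theorem quad_min (d p : ℕ) (hp : p.Prime) (hp4 : p % 4 = 3) (hpd : p ∣ d) (hsq : Squarefree d)
    (hd : d % 8 = 1 ∨ d % 8 = 2 ∨ d % 8 = 3 ∨ d % 8 = 6 ∨ d % 8 = 7)
    (t : L) (ht : t ^ 2 = d) (ht0 : 0 < t) (σ : L ≃ₐ[ℚ] L) (hσ : σ t = -t)
    (x0 y0 : ℤ) (hF : PFund d x0 y0)
    {v : L} (hv : IsU v) (hmem : v ∈ IntermediateField.adjoin ℚ {t}) (h1 : 1 < v) :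
    (x0 : L) + y0 * t ≤ v := by
  obtain ⟨x, y, rfl, h | h⟩ := quad_rep d hsq hd t ht σ hσ hv hmem
  swap
  · exact (no_neg_one p d hp hp4 hpd x y h).elim
  have hL : (x : L) ^ 2 - d * y ^ 2 = 1 := by exact_mod_cast congrArg (Int.cast : ℤ → L) h
  have hprod : ((x : L) + y * t) * (x - y * t) = 1 := by linear_combination hL - (y : L) ^ 2 * ht
  have hz0 : 0 < (x : L) - y * t := by
    by_contra hh
    push Not at hh
    nlinarith
  have hz1 : (x : L) - y * t < 1 := by
    by_contra hh
    push Not at hh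
    nlinarith
  have hx : 0 < x := by
    have : (0 : L) < x := by linarith
    exact_mod_cast this
  have hy : 0 < y := by
    have : (0 : L) < y := by
      by_contra hh
      push Not at hh
      nlinarith
    exact_mod_cast this
  obtain ⟨g1, g2, g3, g4⟩ := hF
  have hxx := g4 x y hx hy h
  have hd0 : 0 < d := Nat.pos_of_ne_zero hsq.ne_zero
  have hyy : y0 ≤ y := by
    have hd0' : (0 : ℤ) < d := by exact_mod_cast hd0
    have : (d : ℤ) * y0 ^ 2 ≤ d * y ^ 2 := by nlinarith
    have := le_of_mul_le_mul_left this hd0'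
    exact (sq_le_sq₀ g2.le hy.le).1 this
  have c1 : (x0 : L) ≤ x := by exact_mod_cast hxx
  have c2 : (y0 : L) ≤ y := by exact_mod_cast hyy
  nlinarith

theorem quad_min2 
    (t : L) (ht : t ^ 2 = 2) (ht0 : 0 < t) (σ : L ≃ₐ[ℚ] L) (hσ : σ t = -t)
    {v : L} (hv : IsU v) (hmem : v ∈ IntermediateField.adjoin ℚ {t}) (h1 : 1 < v) :
    1 + t ≤ v := by
  obtain ⟨x, y, rfl, h⟩ := quad_rep 2 Nat.prime_two.squarefree (by simp) t (by simpa using ht) σ hσ hv hmem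
  have hprod : ((x : L) + y * t) * (x - y * t) = 1 ∨ ((x : L) + y * t) * (x - y * t) = -1 := by
    rcases h with h | h
    · left
      have hL : (x : L) ^ 2 - 2 * y ^ 2 = 1 := by exact_mod_cast congrArg (Int.cast : ℤ → L) h
      linear_combination hL - (y : L) ^ 2 * ht
    · right
      have hL : (x : L) ^ 2 - 2 * y ^ 2 = -1 := by exact_mod_cast congrArg (Int.cast : ℤ → L) h
      linear_combination hL - (y : L) ^ 2 * ht
  have hz0 : -1 < (x : L) - y * t := by
    by_contra hh
    push Not at hh
    rcases hprod with h | h <;> nlinarith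
  have hz1 : (x : L) - y * t < 1 := by
    by_contra hh
    push Not at hh
    rcases hprod with h | h <;> nlinarith
  have hx : 0 < x := by
    have : (0 : L) < x := by linarith
    exact_mod_cast this
  have hy : 0 < y := by
    have : (0 : L) < y := by
      by_contra hh
      push Not at hh
      nlinarith
    exact_mod_cast this
  have c1 : (1 : L) ≤ x := by exact_mod_cast hx
  have c2 : (1 : L) ≤ y := by exact_mod_cast hy
  nlinarith

theorem quad_gen [Archimedean L] (F : IntermediateField ℚ L) (ε : L) (hε : ε ∈ F) (hU : IsU ε) (h1 : 1 < ε)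
    (hmin : ∀ v ∈ F, IsU v → 1 < v → ε ≤ v) (v : L) (hv : v ∈ F) (hvU : IsU v) :
    ∃ n : ℤ, |v| = ε ^ n := by
  have key : ∀ v : L, v ∈ F → IsU v → 0 < v → ∃ n : ℤ, v = ε ^ n := by
    intro v hv hvU h0
    obtain ⟨n, hn1, hn2⟩ := exists_mem_Ico_zpow h0 h1
    have hp : 0 < ε ^ n := zpow_pos (by linarith) n
    refine ⟨n, ?_⟩
    by_contra hne
    have hlt : ε ^ n < v := lt_of_le_of_ne hn1 (Ne.symm hne)
    have := hmin (v / ε ^ n) (div_mem hv (zpow_mem hε n)) (by rw [div_eq_mul_inv]; exact hvU.mul (hU.zpow n).inv)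
      (by rwa [one_lt_div hp])
    rw [le_div_iff₀ hp, mul_comm, ← zpow_add_one₀ (by linarith : ε ≠ 0)] at this
    exact absurd hn2 (not_lt.2 this)
  rcases lt_or_gt_of_ne hvU.1 with h | h
  · rw [abs_of_neg h]
    exact key _ (neg_mem hv) hvU.neg (by linarith)
  · rw [abs_of_pos h]
    exact key _ hv hvU h
end Quad

set_option linter.unusedSectionVars false

section Build
variable {q r s : ℕ} {L : Type*} [Field L] [LinearOrder L] [IsStrictOrderedRing L] [Algebra ℚ L]

/-- the octic field inside `L` -/
def MQ.KL (M : MQ q r s L) : IntermediateField ℚ L := IntermediateField.adjoin ℚ {M.t2, M.tq, M.tr * M.ts}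

theorem MQ.t2_mem (M : MQ q r s L) : M.t2 ∈ M.KL := IntermediateField.subset_adjoin _ _ (by simp)
theorem MQ.tq_mem (M : MQ q r s L) : M.tq ∈ M.KL := IntermediateField.subset_adjoin _ _ (by simp)
theorem MQ.trs_mem (M : MQ q r s L) : M.tr * M.ts ∈ M.KL := IntermediateField.subset_adjoin _ _ (by simp)

/-- The properties tying the system to the fundamental units. -/
structure XS.Good {M : MQ q r s L} (X : XS M) : Prop where
  hE : X.E = 1 + M.t2
  h1 : ∃ x y : ℤ, PFund q x y ∧ X.X1 ^ 2 = x + y * M.tq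
  h2 : ∃ x y : ℤ, PFund (2 * q) x y ∧ X.X2 ^ 2 = x + y * (M.t2 * M.tq)
  h3 : ∃ x y : ℤ, PFund (r * s) x y ∧ X.X3 ^ 2 = x + y * (M.tr * M.ts)
  h4 : ∃ x y : ℤ, PFund (2 * (r * s)) x y ∧ X.X4 ^ 2 = x + y * (M.t2 * (M.tr * M.ts))
  h5 : ∃ x y : ℤ, PFund (q * (r * s)) x y ∧ X.X5 ^ 2 = x + y * (M.tq * (M.tr * M.ts))
  h6 : ∃ x y : ℤ, PFund (2 * (q * (r * s))) x y ∧ X.X6 ^ 2 = x + y * (M.t2 * (M.tq * (M.tr * M.ts)))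
  m1 : X.X1 ∈ M.KL
  m2 : X.X2 ∈ M.KL
  m4 : X.X4 ∈ M.KL
  m5 : X.X5 ∈ M.KL
  m36 : X.X3 * X.X6 ∈ M.KL

set_option maxHeartbeats 4000000 in
theorem exists_XS (M : MQ q r s L) [hq : Fact q.Prime] [hr : Fact r.Prime] [hs : Fact s.Prime]
    (H : LS q r s) (hq8 : q % 8 = 7) (hr8 : r % 8 = 3) (hs8 : s % 8 = 3)
    (n1 : ¬ IsSquare q) (n2 : ¬ IsSquare (2 * q)) (n3 : ¬ IsSquare (r * s)) (n4 : ¬ IsSquare (2 * (r * s)))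
    (n5 : ¬ IsSquare (q * (r * s)))
    (a b : ℤ) (hF : PFund (2 * (q * (r * s))) a b) (hns : ¬ IsSquare (2 * q * (a - 1))) :
    ∃ X : XS M, X.Good := by
  have q0 := hq.out.pos
  have r0 := hr.out.pos
  have s0 := hs.out.pos
  obtain ⟨x1, y1, F1⟩ := exists_PFund q q0 n1
  obtain ⟨x2, y2, F2⟩ := exists_PFund (2 * q) (by positivity) n2
  obtain ⟨x3, y3, F3⟩ := exists_PFund (r * s) (by positivity) n3
  obtain ⟨x4, y4, F4⟩ := exists_PFund (2 * (r * s)) (by positivity) n4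
  obtain ⟨x5, y5, F5⟩ := exists_PFund (q * (r * s)) (by positivity) n5
  obtain ⟨u1, v1, hu1, hv1, hx1, hy1, he1⟩ := nt_q q r s H hq8 hr8 hs8 x1 y1 F1
  obtain ⟨u2, v2, hu2, hv2, hx2, hy2, he2⟩ := nt_2q q r s H hq8 hr8 hs8 x2 y2 F2
  obtain ⟨u3, v3, hu3, hv3, hx3, hy3, he3⟩ := nt_rs q r s H hq8 hr8 hs8 x3 y3 F3
  obtain ⟨u4, v4, hu4, hv4, hx4, hy4, he4⟩ := nt_2rs q r s H hq8 hr8 hs8 x4 y4 F4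
  obtain ⟨u5, v5, hu5, hv5, hx5, hy5, he5⟩ := nt_qrs q r s H hq8 hr8 hs8 x5 y5 F5
  have p2 := M.t2_pos
  have pq := M.tq_pos
  have pr := M.tr_pos
  have ps := M.ts_pos
  have s2 := M.t2_sq
  have sq := M.tq_sq
  have sr := M.tr_sq
  have ss := M.ts_sq
  have i2 : M.t2⁻¹ = M.t2 / 2 := by field_simp; exact s2.symm
  have e1 : (u1 : L) ^ 2 = q * v1 ^ 2 + 2 := by
    have := congrArg (Int.cast : ℤ → L) he1; push_cast at this; linarith
  have e2 : 2 * (u2 : L) ^ 2 = q * v2 ^ 2 + 1 := by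
    have := congrArg (Int.cast : ℤ → L) he2; push_cast at this; linarith
  have e3 : s * (u3 : L) ^ 2 = r * v3 ^ 2 + 1 := by
    have := congrArg (Int.cast : ℤ → L) he3; push_cast at this; linarith
  have e4 : (r * s) * (u4 : L) ^ 2 = 2 * v4 ^ 2 + 1 := by
    have := congrArg (Int.cast : ℤ → L) he4; push_cast at this; linarith
  have e5 : (r * s) * (u5 : L) ^ 2 = q * v5 ^ 2 + 1 := by
    have := congrArg (Int.cast : ℤ → L) he5; push_cast at this; linarith
  have w1 : 2 * (x1 : L) = u1 ^ 2 + q * v1 ^ 2 := by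
    have := congrArg (Int.cast : ℤ → L) hx1; push_cast at this; linarith
  have w2 : (x2 : L) = 2 * u2 ^ 2 + q * v2 ^ 2 := by
    have := congrArg (Int.cast : ℤ → L) hx2; push_cast at this; linarith
  have w3 : (x3 : L) = s * u3 ^ 2 + r * v3 ^ 2 := by
    have := congrArg (Int.cast : ℤ → L) hx3; push_cast at this; linarith
  have w4 : (x4 : L) = r * s * u4 ^ 2 + 2 * v4 ^ 2 := by
    have := congrArg (Int.cast : ℤ → L) hx4; push_cast at this; linarith
  have w5 : (x5 : L) = r * s * u5 ^ 2 + q * v5 ^ 2 := by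
    have := congrArg (Int.cast : ℤ → L) hx5; push_cast at this; linarith
  have z1 : (y1 : L) = u1 * v1 := by rw [hy1]; push_cast; ring
  have z2 : (y2 : L) = 2 * u2 * v2 := by rw [hy2]; push_cast; ring
  have z3 : (y3 : L) = 2 * u3 * v3 := by rw [hy3]; push_cast; ring
  have z4 : (y4 : L) = 2 * u4 * v4 := by rw [hy4]; push_cast; ring
  have z5 : (y5 : L) = 2 * u5 * v5 := by rw [hy5]; push_cast; ring
  have hK : ∀ n : ℕ, (n : L) ∈ M.KL := fun n => natCast_mem _ n
  have hX6 : ∃ X6 d : L, 0 < X6 ∧ (d = 1 ∨ d = -1) ∧ M.a X6 = d * X6⁻¹ ∧ M.b X6 = X6⁻¹ ∧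
      M.c X6 = d * X6⁻¹ ∧ M.e X6 = -(d * X6⁻¹) ∧
      X6 ^ 2 = a + b * (M.t2 * (M.tq * (M.tr * M.ts))) ∧ (u3 * M.ts + v3 * M.tr) * X6 ∈ M.KL := by
    rcases nt_2qrs q r s H hq8 hr8 hs8 a b hF hns with ⟨u, v, hu, hv, hx, hy, he⟩ | ⟨u, v, hu, hv, hx, hy, he⟩
    · have e6 : s * (u : L) ^ 2 = 2 * q * r * v ^ 2 + 1 := by
        have := congrArg (Int.cast : ℤ → L) he; push_cast at this; linarith
      have w6 : (a : L) = s * u ^ 2 + 2 * q * r * v ^ 2 := by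
        have := congrArg (Int.cast : ℤ → L) hx; push_cast at this; linarith
      have z6 : (b : L) = 2 * u * v := by rw [hy]; push_cast; ring
      have hinv : (u * M.ts + v * (M.t2 * M.tq * M.tr))⁻¹ = u * M.ts - v * (M.t2 * M.tq * M.tr) := by
        symm; apply eq_inv_of_mul_eq_one_left
        simp only [← s2, ← sq, ← sr, ← ss] at e6
        linear_combination e6
      refine ⟨u * M.ts + v * (M.t2 * M.tq * M.tr), 1, by positivity, Or.inl rfl, ?_, ?_, ?_, ?_, ?_, ?_⟩
      · rw [hinv]; simp; ring
      · rw [hinv]; simp; ring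
      · rw [hinv]; simp; ring
      · rw [hinv]; simp; ring
      · rw [w6, z6]; simp only [← sq, ← sr, ← ss]; linear_combination v ^ 2 * M.tq ^ 2 * M.tr ^ 2 * s2
      · have : (u3 * M.ts + v3 * M.tr) * (u * M.ts + v * (M.t2 * M.tq * M.tr)) =
            s * u3 * u + r * v3 * v * M.t2 * M.tq + (v3 * u + u3 * v * M.t2 * M.tq) * (M.tr * M.ts) := by
          simp only [← sr, ← ss]; ring
        rw [this]
        have := M.t2_mem; have := M.tq_mem; have := M.trs_mem
        have h1 := hK s; have h2 := hK r; have h3 := hK u; have h4 := hK v; have h5 := hK u3; have h6 := hK v3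
        apply_rules [add_mem, mul_mem]
    · have e6 : 2 * r * (u : L) ^ 2 = q * s * v ^ 2 + 1 := by
        have := congrArg (Int.cast : ℤ → L) he; push_cast at this; linarith
      have w6 : (a : L) = 2 * r * u ^ 2 + q * s * v ^ 2 := by
        have := congrArg (Int.cast : ℤ → L) hx; push_cast at this; linarith
      have z6 : (b : L) = 2 * u * v := by rw [hy]; push_cast; ring
      have hinv : (u * (M.t2 * M.tr) + v * (M.tq * M.ts))⁻¹ = u * (M.t2 * M.tr) - v * (M.tq * M.ts) := by
        symm; apply eq_inv_of_mul_eq_one_left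
        simp only [← s2, ← sq, ← sr, ← ss] at e6
        linear_combination e6
      refine ⟨u * (M.t2 * M.tr) + v * (M.tq * M.ts), -1, by positivity, Or.inr rfl, ?_, ?_, ?_, ?_, ?_, ?_⟩
      · rw [hinv]; simp; ring
      · rw [hinv]; simp; ring
      · rw [hinv]; simp; ring
      · rw [hinv]; simp; ring
      · rw [w6, z6]; simp only [← sq, ← sr, ← ss]; linear_combination u ^ 2 * M.tr ^ 2 * s2
      · have : (u3 * M.ts + v3 * M.tr) * (u * (M.t2 * M.tr) + v * (M.tq * M.ts)) =
            M.t2 * u3 * u * (M.tr * M.ts) + s * u3 * v * M.tq + r * v3 * u * M.t2 + v3 * v * M.tq * (M.tr * M.ts) := by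
          simp only [← sr, ← ss]; ring
        rw [this]
        have := M.t2_mem; have := M.tq_mem; have := M.trs_mem
        have h1 := hK s; have h2 := hK r; have h3 := hK u; have h4 := hK v; have h5 := hK u3; have h6 := hK v3
        apply_rules [add_mem, mul_mem]
  obtain ⟨X6, d, X6_pos, hd, aX6, bX6, cX6, eX6, sX6, mX6⟩ := hX6
  have iE : (1 + M.t2)⁻¹ = M.t2 - 1 := by
    symm; apply eq_inv_of_mul_eq_one_left; linear_combination s2
  have i1 : ((u1 + v1 * M.tq) * (M.t2 / 2))⁻¹ = (u1 - v1 * M.tq) * (M.t2 / 2) := by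
    symm; apply eq_inv_of_mul_eq_one_left
    simp only [← sq] at e1
    linear_combination (1/4) * M.t2 ^ 2 * e1 + (1 / 2) * s2
  have i2 : (u2 * M.t2 + v2 * M.tq)⁻¹ = u2 * M.t2 - v2 * M.tq := by
    symm; apply eq_inv_of_mul_eq_one_left
    linear_combination e2 + u2 ^ 2 * s2 - v2 ^ 2 * sq
  have i3 : (u3 * M.ts + v3 * M.tr)⁻¹ = u3 * M.ts - v3 * M.tr := by
    symm; apply eq_inv_of_mul_eq_one_left
    linear_combination e3 + u3 ^ 2 * ss - v3 ^ 2 * sr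
  have i4 : (u4 * (M.tr * M.ts) + v4 * M.t2)⁻¹ = u4 * (M.tr * M.ts) - v4 * M.t2 := by
    symm; apply eq_inv_of_mul_eq_one_left
    simp only [← sr, ← ss] at e4
    linear_combination e4 - v4 ^ 2 * s2
  have i5 : (u5 * (M.tr * M.ts) + v5 * M.tq)⁻¹ = u5 * (M.tr * M.ts) - v5 * M.tq := by
    symm; apply eq_inv_of_mul_eq_one_left
    simp only [← sr, ← ss, ← sq] at e5
    linear_combination e5
  have h22 : ∀ σ : L ≃ₐ[ℚ] L, σ 2 = 2 := fun σ => map_ofNat σ 2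
  refine ⟨{
    E := 1 + M.t2, X1 := (u1 + v1 * M.tq) * (M.t2 / 2), X2 := u2 * M.t2 + v2 * M.tq
    X3 := u3 * M.ts + v3 * M.tr, X4 := u4 * (M.tr * M.ts) + v4 * M.t2
    X5 := u5 * (M.tr * M.ts) + v5 * M.tq, X6 := X6, d := d
    E_pos := by positivity
    X1_pos := by positivity
    X2_pos := by positivity
    X3_pos := by positivity
    X4_pos := by positivity
    X5_pos := by positivity
    X6_pos := X6_pos, d_eq := hd
    aX6 := aX6, bX6 := bX6, cX6 := cX6, eX6 := eX6
    aE := by rw [iE]; simp; ring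
    bE := by simp
    cE := by simp
    eE := by simp
    aX1 := by simp [h22]; ring
    bX1 := by rw [i1]; simp only [map_mul, map_add, map_div₀, h22, map_natCast, M.b_tq, M.b_t2]; ring
    cX1 := by simp [h22]
    eX1 := by simp [h22]
    aX2 := by rw [i2]; simp; ring
    bX2 := by rw [i2]; simp; ring
    cX2 := by simp
    eX2 := by simp
    aX3 := by simp
    bX3 := by simp
    cX3 := by rw [i3]; simp; ring
    eX3 := by rw [i3]; simp; ring
    aX4 := by rw [i4]; simp; ring
    bX4 := by simp
    cX4 := by rw [i4]; simp; ring
    eX4 := by rw [i4]; simp; ring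
    aX5 := by simp
    bX5 := by rw [i5]; simp; ring
    cX5 := by rw [i5]; simp; ring
    eX5 := by rw [i5]; simp; ring }, ?_⟩
  have k2 := M.t2_mem
  have kq := M.tq_mem
  have krs := M.trs_mem
  have khalf : M.t2 / 2 ∈ M.KL := div_mem k2 (by simpa using hK 2)
  refine ⟨rfl, ⟨x1, y1, F1, ?_⟩, ⟨x2, y2, F2, ?_⟩, ⟨x3, y3, F3, ?_⟩, ⟨x4, y4, F4, ?_⟩, ⟨x5, y5, F5, ?_⟩,
    ⟨a, b, hF, sX6⟩, ?_, ?_, ?_, ?_, mX6⟩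
  · simp only [z1, ← sq] at w1 ⊢
    linear_combination (1 / 4) * (u1 + v1 * M.tq) ^ 2 * s2 - (1 / 2) * w1
  · simp only [w2, z2, ← sq]
    linear_combination u2 ^ 2 * s2
  · simp only [w3, z3, ← sr, ← ss]; ring
  · simp only [w4, z4, ← sr, ← ss]; linear_combination v4 ^ 2 * s2
  · simp only [w5, z5, ← sr, ← ss, ← sq]; ring
  · exact mul_mem (add_mem (hK _) (mul_mem (hK _) kq)) khalf
  · exact add_mem (mul_mem (hK _) k2) (mul_mem (hK _) kq)
  · exact add_mem (mul_mem (hK _) krs) (mul_mem (hK _) k2)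
  · exact add_mem (mul_mem (hK _) krs) (mul_mem (hK _) kq)
end Build

set_option linter.unusedSectionVars false

section Main
variable {q r s : ℕ} {L : Type*} [Field L] [LinearOrder L] [IsStrictOrderedRing L] [Algebra ℚ L]

/-- fundamental unit of a subfield, in `L` -/
def IsFundL (F : IntermediateField ℚ L) (ε : L) : Prop :=
  ε ∈ F ∧ IsU ε ∧ 1 < ε ∧ ∀ v ∈ F, IsU v → 1 < v → ε ≤ v

theorem isU_of_sq (d : ℕ) (t X : L) (x y : ℤ) (ht : t ^ 2 = d) (h : x ^ 2 - d * y ^ 2 = 1)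
    (hX : X ^ 2 = x + y * t) : IsU X := by
  have hL : (x : L) ^ 2 - d * y ^ 2 = 1 := by exact_mod_cast congrArg (Int.cast : ℤ → L) h
  have hp : X ^ 2 * (x - y * t) = 1 := by rw [hX]; linear_combination hL - (y : L) ^ 2 * ht
  have hX0 : X ≠ 0 := by
    rintro rfl; simp at hp
  have hi : X⁻¹ ^ 2 = x - y * t := by
    rw [inv_pow]; exact inv_eq_of_mul_eq_one_right hp
  have hc : ∀ n : ℤ, IsIntegral ℤ (n : L) := fun n => by
    simpa using isIntegral_algebraMap (R := ℤ) (A := L) (x := n)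
  have ht' : IsIntegral ℤ t := by
    refine IsIntegral.of_pow (n := 2) (by norm_num) ?_
    rw [ht]; exact_mod_cast hc d
  refine ⟨hX0, IsIntegral.of_pow (n := 2) (by norm_num) ?_, IsIntegral.of_pow (n := 2) (by norm_num) ?_⟩
  · rw [hX]; exact (hc x).add ((hc y).mul ht')
  · rw [hi]; exact (hc x).sub ((hc y).mul ht')

theorem fund_of_PFund (d p : ℕ) (hp : p.Prime) (hp4 : p % 4 = 3) (hpd : p ∣ d) (hsq : Squarefree d)
    (hd : d % 8 = 1 ∨ d % 8 = 2 ∨ d % 8 = 3 ∨ d % 8 = 6 ∨ d % 8 = 7)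
    (t : L) (ht : t ^ 2 = d) (ht0 : 0 < t) (σ : L ≃ₐ[ℚ] L) (hσ : σ t = -t) (X : L)
    (h : ∃ x y : ℤ, PFund d x y ∧ X ^ 2 = x + y * t) :
    IsU X ∧ IsFundL (IntermediateField.adjoin ℚ {t}) (X ^ 2) := by
  obtain ⟨x, y, hF, hX⟩ := h
  have hU := isU_of_sq d t X x y ht hF.2.2.1 hX
  refine ⟨hU, ?_, hU.pow 2, ?_, ?_⟩
  · rw [hX]
    exact add_mem (intCast_mem _ _) (mul_mem (intCast_mem _ _) (IntermediateField.subset_adjoin _ _ (by simp)))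
  · rw [hX]
    have h1 : (1 : L) < x := by exact_mod_cast hF.1
    have h2 : (0 : L) < y := by exact_mod_cast hF.2.1
    nlinarith [mul_pos h2 ht0]
  · intro v hv hvU h1
    rw [hX]
    exact quad_min d p hp hp4 hpd hsq hd t ht ht0 σ hσ x y hF hvU hv h1

variable {M : MQ q r s L}

structure XS.Fund (X : XS M) : Prop where
  f0 : IsU X.E ∧ IsFundL (IntermediateField.adjoin ℚ {M.t2}) X.E
  f1 : IsU X.X1 ∧ IsFundL (IntermediateField.adjoin ℚ {M.tq}) (X.X1 ^ 2)
  f2 : IsU X.X2 ∧ IsFundL (IntermediateField.adjoin ℚ {M.t2 * M.tq}) (X.X2 ^ 2)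
  f3 : IsU X.X3 ∧ IsFundL (IntermediateField.adjoin ℚ {M.tr * M.ts}) (X.X3 ^ 2)
  f4 : IsU X.X4 ∧ IsFundL (IntermediateField.adjoin ℚ {M.t2 * (M.tr * M.ts)}) (X.X4 ^ 2)
  f5 : IsU X.X5 ∧ IsFundL (IntermediateField.adjoin ℚ {M.tq * (M.tr * M.ts)}) (X.X5 ^ 2)
  f6 : IsU X.X6 ∧ IsFundL (IntermediateField.adjoin ℚ {M.t2 * (M.tq * (M.tr * M.ts))}) (X.X6 ^ 2)

theorem sqfree_facts (hq : q.Prime) (hr : r.Prime) (hs : s.Prime)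
    (hqr : q ≠ r) (hqs : q ≠ s) (hrs : r ≠ s) (hq2 : q ≠ 2) (hr2 : r ≠ 2) (hs2 : s ≠ 2) :
    Squarefree q ∧ Squarefree (2 * q) ∧ Squarefree (r * s) ∧ Squarefree (2 * (r * s)) ∧
    Squarefree (q * (r * s)) ∧ Squarefree (2 * (q * (r * s))) := by
  have c2q : Nat.Coprime 2 q := (Nat.coprime_primes Nat.prime_two hq).2 hq2.symm
  have c2r : Nat.Coprime 2 r := (Nat.coprime_primes Nat.prime_two hr).2 hr2.symm
  have c2s : Nat.Coprime 2 s := (Nat.coprime_primes Nat.prime_two hs).2 hs2.symm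
  have cqr : Nat.Coprime q r := (Nat.coprime_primes hq hr).2 hqr
  have cqs : Nat.Coprime q s := (Nat.coprime_primes hq hs).2 hqs
  have crs : Nat.Coprime r s := (Nat.coprime_primes hr hs).2 hrs
  have S2 := Nat.prime_two.squarefree
  have Sq := hq.prime.squarefree
  have Sr := hr.prime.squarefree
  have Ss := hs.prime.squarefree
  have Srs := (Nat.squarefree_mul crs).2 ⟨Sr, Ss⟩
  have cq_rs := Nat.Coprime.mul_right cqr cqs
  have c2_rs := Nat.Coprime.mul_right c2r c2s
  have Sqrs := (Nat.squarefree_mul cq_rs).2 ⟨Sq, Srs⟩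
  exact ⟨Sq, (Nat.squarefree_mul c2q).2 ⟨S2, Sq⟩, Srs, (Nat.squarefree_mul c2_rs).2 ⟨S2, Srs⟩, Sqrs,
    (Nat.squarefree_mul (c2q.mul_right c2_rs)).2 ⟨S2, Sqrs⟩⟩

theorem XS.Good.fund {X : XS M} (G : X.Good) (hq : q.Prime) (hr : r.Prime) (hs : s.Prime)
    (hqr : q ≠ r) (hqs : q ≠ s) (hrs : r ≠ s) (hq8 : q % 8 = 7) (hr8 : r % 8 = 3) (hs8 : s % 8 = 3) :
    X.Fund := by
  obtain ⟨Sq, S2q, Srs, S2rs, Sqrs, S2qrs⟩ := sqfree_facts hq hr hs hqr hqs hrs (by omega) (by omega) (by omega)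
  have mrs : (r * s) % 8 = 1 := by rw [Nat.mul_mod, hr8, hs8]
  have mqrs : (q * (r * s)) % 8 = 7 := by rw [Nat.mul_mod, hq8, mrs]
  have p2 := M.t2_pos
  have pq := M.tq_pos
  have pr := M.tr_pos
  have ps := M.ts_pos
  have s2 := M.t2_sq
  have sq := M.tq_sq
  have sr := M.tr_sq
  have ss := M.ts_sq
  refine ⟨?_, ?_, ?_, ?_, ?_, ?_, ?_⟩
  · have hc : ∀ n : ℤ, IsIntegral ℤ (n : L) := fun n => by
      simpa using isIntegral_algebraMap (R := ℤ) (A := L) (x := n)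
    have ht' : IsIntegral ℤ M.t2 := by
      refine IsIntegral.of_pow (n := 2) (by norm_num) ?_
      rw [s2]; exact_mod_cast hc 2
    have h1 : IsIntegral ℤ (1 : L) := isIntegral_one
    have hU : IsU (1 + M.t2) := by
      refine ⟨by positivity, h1.add ht', ?_⟩
      have : (1 + M.t2)⁻¹ = M.t2 - 1 := by
        symm; apply eq_inv_of_mul_eq_one_left; linear_combination s2
      rw [this]; exact ht'.sub h1
    rw [G.hE]
    refine ⟨hU, ?_, hU, by linarith, ?_⟩
    · exact add_mem (one_mem _) (IntermediateField.subset_adjoin _ _ (by simp))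
    · intro v hv hvU h1
      exact quad_min2 M.t2 s2 p2 M.a M.a_t2 hvU hv h1
  · exact fund_of_PFund q q hq (by omega) dvd_rfl Sq (by omega) _ sq pq M.b (by simp) _ G.h1
  · exact fund_of_PFund (2 * q) q hq (by omega) (dvd_mul_left _ _) S2q (by omega) _
      (by rw [mul_pow, s2, sq]; push_cast; rfl) (by positivity) M.a (by simp) _ G.h2
  · exact fund_of_PFund (r * s) r hr (by omega) (dvd_mul_right _ _) Srs (by omega) _
      (by rw [mul_pow, sr, ss]; push_cast; rfl) (by positivity) M.c (by simp) _ G.h3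
  · exact fund_of_PFund (2 * (r * s)) r hr (by omega) ⟨2 * s, by ring⟩ S2rs (by omega) _
      (by rw [mul_pow, mul_pow, sr, ss, s2]; push_cast; rfl) (by positivity) M.a (by simp) _ G.h4
  · exact fund_of_PFund (q * (r * s)) q hq (by omega) (dvd_mul_right _ _) Sqrs (by omega) _
      (by rw [mul_pow, mul_pow, sr, ss, sq]; push_cast; rfl) (by positivity) M.b (by simp) _ G.h5
  · exact fund_of_PFund (2 * (q * (r * s))) q hq (by omega) ⟨2 * (r * s), by ring⟩ S2qrs (by omega) _
      (by rw [mul_pow, mul_pow, mul_pow, sr, ss, sq, s2]; push_cast; rfl) (by positivity) M.a (by simp) _ G.h6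

theorem fixed_of_adjoin (S : Set L) (σ : L ≃ₐ[ℚ] L) (hS : ∀ y ∈ S, σ y = y) {y : L}
    (hy : y ∈ IntermediateField.adjoin ℚ S) : σ y = y := by
  induction hy using IntermediateField.adjoin_induction with
  | mem x hx => exact hS x hx
  | algebraMap x => exact σ.commutes x
  | add x y _ _ hx hy => rw [map_add, hx, hy]
  | inv x _ hx => rw [map_inv₀, hx]
  | mul x y _ _ hx hy => rw [map_mul, hx, hy]

theorem map_mem_adjoin (S : Set L) (K : IntermediateField ℚ L) (σ : L ≃ₐ[ℚ] L) (hS : ∀ y ∈ S, σ y ∈ K) {y : L}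
    (hy : y ∈ IntermediateField.adjoin ℚ S) : σ y ∈ K := by
  induction hy using IntermediateField.adjoin_induction with
  | mem x hx => exact hS x hx
  | algebraMap x => rw [σ.commutes]; exact K.algebraMap_mem x
  | add x y _ _ hx hy => rw [map_add]; exact add_mem hx hy
  | inv x _ hx => rw [map_inv₀]; exact inv_mem hx
  | mul x y _ _ hx hy => rw [map_mul]; exact mul_mem hx hy

theorem MQ.k_fix (M : MQ q r s L) {v : L} (hv : v ∈ M.KL) : M.c (M.e v) = v := by
  refine fixed_of_adjoin _ (M.e.trans M.c) ?_ hv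
  rintro y (rfl | rfl | rfl) <;> simp

theorem MQ.a_mem (M : MQ q r s L) {v : L} (hv : v ∈ M.KL) : M.a v ∈ M.KL := by
  refine map_mem_adjoin _ M.KL M.a ?_ hv
  have h1 := M.t2_mem; have h2 := M.tq_mem; have h3 := M.trs_mem
  rintro y (rfl | rfl | rfl) <;> simp [*]
theorem MQ.b_mem (M : MQ q r s L) {v : L} (hv : v ∈ M.KL) : M.b v ∈ M.KL := by
  refine map_mem_adjoin _ M.KL M.b ?_ hv
  have h1 := M.t2_mem; have h2 := M.tq_mem; have h3 := M.trs_mem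
  rintro y (rfl | rfl | rfl) <;> simp [*]
theorem MQ.c_mem (M : MQ q r s L) {v : L} (hv : v ∈ M.KL) : M.c v ∈ M.KL := by
  refine map_mem_adjoin _ M.KL M.c ?_ hv
  have h1 := M.t2_mem; have h2 := M.tq_mem; have h3 := M.trs_mem
  rintro y (rfl | rfl | rfl) <;> simp [*]

theorem norm_mem (M : MQ q r s L) (t1 t2 td : L) (m1 m2 : ℕ) (ht1 : t1 ^ 2 = m1) (ht2 : t2 ^ 2 = m2)
    (ρ1 ρ2 : L ≃ₐ[ℚ] L) (h1 : ρ1 t1 = -t1) (h2 : ρ1 t2 = t2) (h3 : ρ1 td = td)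
    (h4 : ρ2 t2 = -t2) (h5 : ρ2 td = td)
    (g1 : M.t2 ∈ IntermediateField.adjoin ℚ {t1, t2, td})
    (g2 : M.tq ∈ IntermediateField.adjoin ℚ {t1, t2, td})
    (g3 : M.tr * M.ts ∈ IntermediateField.adjoin ℚ {t1, t2, td})
    {z : L} (hz : z ∈ M.KL) (hz1 : ρ1 z = z) (hz2 : ρ2 z = z) :
    z ∈ IntermediateField.adjoin ℚ {td} := by
  have hz0 : z ∈ IntermediateField.adjoin ℚ {t1, t2, td} := by
    have : M.KL ≤ IntermediateField.adjoin ℚ {t1, t2, td} := by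
      rw [MQ.KL, IntermediateField.adjoin_le_iff]
      rintro x (rfl | rfl | rfl)
      · exact g1
      · exact g2
      · exact g3
    exact this hz
  have hz' := mem_of_fixed {t2, td} t1 m1 (by simpa using ht1) ρ1 (by
    rintro y (rfl | rfl)
    · exact h2
    · exact h3) h1 hz0 hz1
  exact mem_of_fixed {td} t2 m2 (by simpa using ht2) ρ2 (by
    rintro y rfl
    exact h5) h4 hz' hz2
end Main

set_option linter.unusedSectionVars false

section MainU
variable {q r s : ℕ} {L : Type*} [Field L] [LinearOrder L] [IsStrictOrderedRing L] [Algebra ℚ L]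
variable {M : MQ q r s L}

theorem mem_adj_of_sq {F : IntermediateField ℚ L} {x y t : L} (n : ℕ) (ht : t ^ 2 = n) (hn : t ≠ 0)
    (hxt : t * x = y) (h : y ∈ F) (h' : t ∈ F) : x ∈ F := by
  have : x = t⁻¹ * y := by rw [← hxt, inv_mul_cancel_left₀ hn]
  rw [this]; exact mul_mem (inv_mem h') h

theorem main_units [Archimedean L] (X : XS M) (F : X.Fund) (v : L) (hv : v ∈ M.KL) (hU : IsU v) :
    ∃ k m1 m2 m3 m4 m5 m6 : ℤ, Even (m3 + m6) ∧
      (v = X.P k m1 m2 m3 m4 m5 m6 ∨ v = - X.P k m1 m2 m3 m4 m5 m6) := by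
  have p2 := M.t2_pos
  have pq := M.tq_pos
  have pr := M.tr_pos
  have ps := M.ts_pos
  have s2 : M.t2 ^ 2 = (2 : ℕ) := by exact_mod_cast M.t2_sq
  have sq := M.tq_sq
  have srs : (M.tr * M.ts) ^ 2 = (r * s : ℕ) := by rw [mul_pow, M.tr_sq, M.ts_sq]; push_cast; rfl
  have sub : ∀ (S : Set L) x, x ∈ S → x ∈ IntermediateField.adjoin ℚ S :=
    fun S x h => IntermediateField.subset_adjoin ℚ S h
  have ma := M.a_mem hv
  have mb := M.b_mem hv
  have mc := M.c_mem hv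
  have mab := M.a_mem mb
  have mac := M.a_mem mc
  have mbc := M.b_mem mc
  have mabc := M.a_mem mbc
  have ua := hU.map M.a
  have ub := hU.map M.b
  have uc := hU.map M.c
  have uab := ub.map M.a
  have uac := uc.map M.a
  have ubc := uc.map M.b
  have uabc := ubc.map M.a
  obtain ⟨n0, h0⟩ := quad_gen _ _ F.f0.2.1 F.f0.2.2.1 F.f0.2.2.2.1 F.f0.2.2.2.2
    (v * M.b v * M.c v * M.b (M.c v))
    (by
      refine norm_mem M M.tq (M.tr * M.ts) M.t2 _ _ sq srs M.b M.c (by simp) (by simp) (by simp) (by simp) (by simp)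
        (sub _ _ (by simp)) (sub _ _ (by simp)) (sub _ _ (by simp))
        (mul_mem (mul_mem (mul_mem hv mb) mc) mbc) ?_ ?_ <;>
      simp only [map_mul, M.aa, M.bb, M.cc, M.ba, M.ca, M.cb] <;> ring)
    (((hU.mul ub).mul uc).mul ubc)
  obtain ⟨n1, h1⟩ := quad_gen _ _ F.f1.2.1 F.f1.2.2.1 F.f1.2.2.2.1 F.f1.2.2.2.2
    (v * M.a v * M.c v * M.a (M.c v))
    (by
      refine norm_mem M M.t2 (M.tr * M.ts) M.tq _ _ s2 srs M.a M.c (by simp) (by simp) (by simp) (by simp) (by simp)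
        (sub _ _ (by simp)) (sub _ _ (by simp)) (sub _ _ (by simp))
        (mul_mem (mul_mem (mul_mem hv ma) mc) mac) ?_ ?_ <;>
      simp only [map_mul, M.aa, M.bb, M.cc, M.ba, M.ca, M.cb] <;> ring)
    (((hU.mul ua).mul uc).mul uac)
  obtain ⟨n3, h3⟩ := quad_gen _ _ F.f3.2.1 F.f3.2.2.1 F.f3.2.2.2.1 F.f3.2.2.2.2
    (v * M.a v * M.b v * M.a (M.b v))
    (by
      refine norm_mem M M.t2 M.tq (M.tr * M.ts) _ _ s2 sq M.a M.b (by simp) (by simp) (by simp) (by simp) (by simp)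
        (sub _ _ (by simp)) (sub _ _ (by simp)) (sub _ _ (by simp))
        (mul_mem (mul_mem (mul_mem hv ma) mb) mab) ?_ ?_ <;>
      simp only [map_mul, M.aa, M.bb, M.cc, M.ba, M.ca, M.cb] <;> ring)
    (((hU.mul ua).mul ub).mul uab)
  obtain ⟨n2, h2⟩ := quad_gen _ _ F.f2.2.1 F.f2.2.2.1 F.f2.2.2.2.1 F.f2.2.2.2.2
    (v * M.a (M.b v) * M.c v * M.a (M.b (M.c v)))
    (by
      refine norm_mem M M.t2 (M.tr * M.ts) (M.t2 * M.tq) _ _ s2 srs (M.b.trans M.a) M.c (by simp) (by simp) (by simp) (by simp) (by simp)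
        (sub _ _ (by simp)) (mem_adj_of_sq _ s2 p2.ne' rfl (sub _ _ (by simp)) (sub _ _ (by simp))) (sub _ _ (by simp))
        (mul_mem (mul_mem (mul_mem hv mab) mc) mabc) ?_ ?_ <;>
      simp only [AlgEquiv.trans_apply, map_mul, M.aa, M.bb, M.cc, M.ba, M.ca, M.cb] <;> ring)
    (((hU.mul uab).mul uc).mul uabc)
  obtain ⟨n4, h4⟩ := quad_gen _ _ F.f4.2.1 F.f4.2.2.1 F.f4.2.2.2.1 F.f4.2.2.2.2
    (v * M.a (M.c v) * M.b v * M.a (M.b (M.c v)))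
    (by
      refine norm_mem M M.t2 M.tq (M.t2 * (M.tr * M.ts)) _ _ s2 sq (M.c.trans M.a) M.b (by simp) (by simp) (by simp) (by simp) (by simp)
        (sub _ _ (by simp)) (sub _ _ (by simp)) (mem_adj_of_sq _ s2 p2.ne' rfl (sub _ _ (by simp)) (sub _ _ (by simp)))
        (mul_mem (mul_mem (mul_mem hv mac) mb) mabc) ?_ ?_ <;>
      simp only [AlgEquiv.trans_apply, map_mul, M.aa, M.bb, M.cc, M.ba, M.ca, M.cb] <;> ring)
    (((hU.mul uac).mul ub).mul uabc)
  obtain ⟨n5, h5⟩ := quad_gen _ _ F.f5.2.1 F.f5.2.2.1 F.f5.2.2.2.1 F.f5.2.2.2.2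
    (v * M.b (M.c v) * M.a v * M.a (M.b (M.c v)))
    (by
      refine norm_mem M M.tq M.t2 (M.tq * (M.tr * M.ts)) _ _ sq s2 (M.c.trans M.b) M.a (by simp) (by simp) (by simp) (by simp) (by simp)
        (sub _ _ (by simp)) (sub _ _ (by simp)) (mem_adj_of_sq _ sq pq.ne' rfl (sub _ _ (by simp)) (sub _ _ (by simp)))
        (mul_mem (mul_mem (mul_mem hv mbc) ma) mabc) ?_ ?_ <;>
      simp only [AlgEquiv.trans_apply, map_mul, M.aa, M.bb, M.cc, M.ba, M.ca, M.cb] <;> ring)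
    (((hU.mul ubc).mul ua).mul uabc)
  obtain ⟨n6, h6⟩ := quad_gen _ _ F.f6.2.1 F.f6.2.2.1 F.f6.2.2.2.1 F.f6.2.2.2.2
    (v * M.b (M.c v) * M.a (M.c v) * M.a (M.b v))
    (by
      refine norm_mem M M.tq M.t2 (M.t2 * (M.tq * (M.tr * M.ts))) _ _ sq s2 (M.c.trans M.b) (M.c.trans M.a) (by simp) (by simp) (by simp) (by simp) (by simp)
        (sub _ _ (by simp)) (sub _ _ (by simp))
        (mem_adj_of_sq _ sq pq.ne' rfl (mem_adj_of_sq _ s2 p2.ne' rfl (sub _ _ (by simp)) (sub _ _ (by simp))) (sub _ _ (by simp)))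
        (mul_mem (mul_mem (mul_mem hv mbc) mac) mab) ?_ ?_ <;>
      simp only [AlgEquiv.trans_apply, map_mul, M.aa, M.bb, M.cc, M.ba, M.ca, M.cb] <;> ring)
    (((hU.mul ubc).mul uac).mul uab)
  have hN : (v * M.a v * M.b v * M.a (M.b v)) * M.c (v * M.a v * M.b v * M.a (M.b v)) = 1 := by
    have x3 := X.X3_pos.ne'
    rcases abs_choice (v * M.a v * M.b v * M.a (M.b v)) with hh | hh
    · rw [← hh, h3, map_zpow₀, map_pow, X.cX3]
      rw [← mul_zpow, ← mul_pow, mul_inv_cancel₀ x3]; simp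
    · have hh' : v * M.a v * M.b v * M.a (M.b v) = - (X.X3 ^ 2) ^ n3 := by
        rw [← h3, hh, neg_neg]
      rw [hh', map_neg, map_zpow₀, map_pow, X.cX3, neg_mul_neg]
      rw [← mul_zpow, ← mul_pow, mul_inv_cancel₀ x3]; simp
  have hv4 : v ^ 4 = X.P n0 (2 * n1) (2 * n2) (2 * n3) (2 * n4) (2 * n5) (2 * n6) := by
    have e : v ^ 4 = |v ^ 4| := (abs_of_nonneg (by positivity)).symm
    have e2 : v ^ 4 = v ^ 4 * ((v * M.a v * M.b v * M.a (M.b v)) * M.c (v * M.a v * M.b v * M.a (M.b v))) ^ 3 := by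
      rw [hN]; ring
    have e3 : v ^ 4 = (v * M.b v * M.c v * M.b (M.c v)) * (v * M.a v * M.c v * M.a (M.c v)) *
      (v * M.a (M.b v) * M.c v * M.a (M.b (M.c v))) * (v * M.a v * M.b v * M.a (M.b v)) *
      (v * M.a (M.c v) * M.b v * M.a (M.b (M.c v))) * (v * M.b (M.c v) * M.a v * M.a (M.b (M.c v))) *
      (v * M.b (M.c v) * M.a (M.c v) * M.a (M.b v)) := by
      rw [e2]; simp only [map_mul, M.ca, M.cb]; ring
    rw [e, e3]
    simp only [abs_mul] at h0 h1 h2 h3 h4 h5 h6 ⊢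
    rw [h0, h1, h2, h3, h4, h5, h6]
    simp only [XS.P, zpow_mul]
    norm_cast
  have ha4 : ((M.a v) ^ 2) ^ 2 = (-1) ^ (n0 + 2 * n1 + 2 * n2) * X.P (-n0) (2 * n1) (-(2 * n2)) (2 * n3) (-(2 * n4)) (2 * n5) (-(2 * n6)) := by
    have : ((M.a v) ^ 2) ^ 2 = M.a (v ^ 4) := by rw [map_pow]; ring
    rw [this, hv4, X.aP, X.d_even (even_two_mul _), mul_one]
  have ev := pos_even _ (X.P_pos _ _ _ _ _ _ _) ha4
  have ev0 : Even n0 := by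
    have : n0 = (n0 + 2 * n1 + 2 * n2) - 2 * (n1 + n2) := by ring
    rw [this]; exact ev.sub (even_two_mul _)
  obtain ⟨k, rfl⟩ := even_iff_exists_two_mul.1 ev0
  rw [← X.P_sq] at hv4
  have hv2 : v ^ 2 = X.P k n1 n2 n3 n4 n5 n6 := by
    have : (v ^ 2) ^ 2 = X.P k n1 n2 n3 n4 n5 n6 ^ 2 := by rw [← hv4]; ring
    exact (pow_left_inj₀ (sq_nonneg v) (X.P_pos _ _ _ _ _ _ _).le two_ne_zero).1 this
  obtain ⟨k', m1, m2, m3, m4, m5, m6, -, -, -, -, -, -, -, h, h'⟩ := X.parity v (M.k_fix hv) _ _ _ _ _ _ _ hv2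
  exact ⟨k', m1, m2, m3, m4, m5, m6, h, h'⟩
end MainU

set_option linter.unusedSectionVars false

section Transfer
variable {q r s : ℕ} {L : Type*} [Field L] [LinearOrder L] [IsStrictOrderedRing L] [Algebra ℚ L]
variable {M : MQ q r s L}

theorem phi_zpow {U : Type*} [CommGroup U] (φ : U →* L) (u : U) (n : ℤ) : φ (u ^ n) = φ u ^ n := by
  have h : ∀ w : U, φ w⁻¹ = (φ w)⁻¹ := fun w => by
    refine eq_inv_of_mul_eq_one_left ?_
    rw [← map_mul]; simp
  cases n with
  | ofNat n => simp
  | negSucc n => rw [zpow_negSucc, h, map_pow, zpow_negSucc]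

theorem XS.P_split (X : XS M) (k m1 m2 m3 m4 m5 j : ℤ) :
    X.P k m1 m2 m3 m4 m5 (m3 + 2 * j) =
      X.E ^ k * X.X1 ^ m1 * X.X2 ^ m2 * (X.X3 * X.X6) ^ m3 * X.X4 ^ m4 * X.X5 ^ m5 * (X.X6 ^ 2) ^ j := by
  have h : X.X6 ^ (2 * j) = (X.X6 ^ 2) ^ j := by rw [zpow_mul]; norm_cast
  rw [XS.P, zpow_add₀ X.X6_pos.ne', mul_zpow, h]; ring

theorem XS.uniq (X : XS M) (y : L) (k m1 m2 m3 m4 m5 m6 k' m1' m2' m3' m4' m5' m6' : ℤ)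
    (h : y = X.P k m1 m2 m3 m4 m5 m6 ∨ y = - X.P k m1 m2 m3 m4 m5 m6)
    (h' : y = X.P k' m1' m2' m3' m4' m5' m6' ∨ y = - X.P k' m1' m2' m3' m4' m5' m6') :
    (m1 : ZMod 2) = m1' ∧ (m2 : ZMod 2) = m2' ∧ (m3 : ZMod 2) = m3' ∧ (m4 : ZMod 2) = m4' ∧
      (m5 : ZMod 2) = m5' := by
  have e : X.P k m1 m2 m3 m4 m5 m6 = X.P k' m1' m2' m3' m4' m5' m6' := by
    have p := X.P_pos k m1 m2 m3 m4 m5 m6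
    have p' := X.P_pos k' m1' m2' m3' m4' m5' m6'
    rcases h with h | h <;> rcases h' with h' | h' <;> linarith
  have e1 : (1 : L) ^ 2 = X.P (k + -k') (m1 + -m1') (m2 + -m2') (m3 + -m3') (m4 + -m4') (m5 + -m5') (m6 + -m6') := by
    rw [← X.P_mul, e, X.P_mul]; simp [XS.P]
  obtain ⟨k', n1, n2, n3, n4, n5, n6, -, g1, g2, g3, g4, g5, -, -⟩ := X.parity 1 (by simp) _ _ _ _ _ _ _ e1
  have key : ∀ a b c : ℤ, a + -b = 2 * c → (a : ZMod 2) = b := by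
    intro a b c h
    rw [ZMod.intCast_eq_intCast_iff_dvd_sub]
    exact ⟨-c, by push_cast; linarith⟩
  exact ⟨key _ _ _ g1, key _ _ _ g2, key _ _ _ g3, key _ _ _ g4, key _ _ _ g5⟩

theorem transfer [Archimedean L] (X : XS M) (G : X.Good) (F : X.Fund) {U : Type*} [CommGroup U]
    (φ : U →* L) (hinj : Function.Injective φ) (hmem : ∀ u, φ u ∈ M.KL ∧ IsU (φ u))
    (hsurj : ∀ y ∈ M.KL, IsU y → ∃ u, φ u = y) (n : U) (hn : φ n = -1) :
    (∃ e2 eq e2q ers e2rs eqrs e2qrs xq x2q x2rs xqrs xmix : U,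
      φ e2 = X.E ∧ φ eq = X.X1 ^ 2 ∧ φ e2q = X.X2 ^ 2 ∧ φ ers = X.X3 ^ 2 ∧ φ e2rs = X.X4 ^ 2 ∧
      φ eqrs = X.X5 ^ 2 ∧ φ e2qrs = X.X6 ^ 2 ∧
      xq ^ 2 = eq ∧ x2q ^ 2 = e2q ∧ x2rs ^ 2 = e2rs ∧ xqrs ^ 2 = eqrs ∧
      xmix ^ 2 = ers * e2qrs ∧
      (⊤ : Subgroup U) =
        Subgroup.closure {n, e2, ers, e2qrs, xq, x2q, x2rs, xqrs, xmix}) ∧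
    (Subgroup.closure {u : U | ∃ K ∈ ({IntermediateField.adjoin ℚ {M.t2}, IntermediateField.adjoin ℚ {M.tq},
      IntermediateField.adjoin ℚ {M.t2 * M.tq}, IntermediateField.adjoin ℚ {M.tr * M.ts},
      IntermediateField.adjoin ℚ {M.t2 * (M.tr * M.ts)}, IntermediateField.adjoin ℚ {M.tq * (M.tr * M.ts)},
      IntermediateField.adjoin ℚ {M.t2 * (M.tq * (M.tr * M.ts))}} : Set (IntermediateField ℚ L)),
      φ u ∈ K}).index = 2 ^ 5 := by
  have mE : X.E ∈ M.KL := by rw [G.hE]; exact add_mem (one_mem _) M.t2_mem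
  have m33 : X.X3 ^ 2 ∈ M.KL := by
    obtain ⟨x, y, -, h⟩ := G.h3
    rw [h]; exact add_mem (intCast_mem _ _) (mul_mem (intCast_mem _ _) M.trs_mem)
  have m66 : X.X6 ^ 2 ∈ M.KL := by
    obtain ⟨x, y, -, h⟩ := G.h6
    rw [h]; exact add_mem (intCast_mem _ _) (mul_mem (intCast_mem _ _)
      (mul_mem M.t2_mem (mul_mem M.tq_mem M.trs_mem)))
  obtain ⟨e2, he2⟩ := hsurj _ mE F.f0.1
  obtain ⟨xq, hxq⟩ := hsurj _ G.m1 F.f1.1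
  obtain ⟨x2q, hx2q⟩ := hsurj _ G.m2 F.f2.1
  obtain ⟨x2rs, hx2rs⟩ := hsurj _ G.m4 F.f4.1
  obtain ⟨xqrs, hxqrs⟩ := hsurj _ G.m5 F.f5.1
  obtain ⟨xmix, hxmix⟩ := hsurj _ G.m36 (F.f3.1.mul F.f6.1)
  obtain ⟨ers, hers⟩ := hsurj _ m33 (F.f3.1.pow 2)
  obtain ⟨e2qrs, he2qrs⟩ := hsurj _ m66 (F.f6.1.pow 2)
  have hform : ∀ u, ∃ k m1 m2 m3 m4 m5 j : ℤ,
      (φ u = X.P k m1 m2 m3 m4 m5 (m3 + 2 * j) ∨ φ u = -X.P k m1 m2 m3 m4 m5 (m3 + 2 * j)) := by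
    intro u
    obtain ⟨k, m1, m2, m3, m4, m5, m6, ⟨c, hc⟩, h⟩ := main_units X F _ (hmem u).1 (hmem u).2
    refine ⟨k, m1, m2, m3, m4, m5, c - m3, ?_⟩
    rwa [show m3 + 2 * (c - m3) = m6 by linarith]
  have hP : ∀ k m1 m2 m3 m4 m5 j : ℤ,
      φ (e2 ^ k * xq ^ m1 * x2q ^ m2 * xmix ^ m3 * x2rs ^ m4 * xqrs ^ m5 * e2qrs ^ j) =
      X.P k m1 m2 m3 m4 m5 (m3 + 2 * j) := by
    intro k m1 m2 m3 m4 m5 j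
    rw [X.P_split]
    simp only [map_mul, phi_zpow, he2, hxq, hx2q, hx2rs, hxqrs, hxmix, he2qrs]
  have hgen : ∀ u, ∃ k m1 m2 m3 m4 m5 j : ℤ, ∃ w : U, (w = 1 ∨ w = n) ∧
      (φ u = X.P k m1 m2 m3 m4 m5 (m3 + 2 * j) ∨ φ u = -X.P k m1 m2 m3 m4 m5 (m3 + 2 * j)) ∧
      u = w * (e2 ^ k * xq ^ m1 * x2q ^ m2 * xmix ^ m3 * x2rs ^ m4 * xqrs ^ m5 * e2qrs ^ j) := by
    intro u
    obtain ⟨k, m1, m2, m3, m4, m5, j, h⟩ := hform u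
    rcases h with h | h
    · exact ⟨k, m1, m2, m3, m4, m5, j, 1, Or.inl rfl, Or.inl h, hinj (by rw [h, one_mul, hP])⟩
    · exact ⟨k, m1, m2, m3, m4, m5, j, n, Or.inr rfl, Or.inr h, hinj (by rw [h, map_mul, hn, hP, neg_one_mul])⟩
  constructor
  · refine ⟨e2, xq ^ 2, x2q ^ 2, ers, x2rs ^ 2, xqrs ^ 2, e2qrs, xq, x2q, x2rs, xqrs, xmix, he2,
      by rw [map_pow, hxq], by rw [map_pow, hx2q], hers, by rw [map_pow, hx2rs], by rw [map_pow, hxqrs], he2qrs,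
      rfl, rfl, rfl, rfl, ?_, ?_⟩
    · apply hinj
      rw [map_pow, map_mul, hxmix, hers, he2qrs, mul_pow]
    · symm
      rw [Subgroup.eq_top_iff']
      intro u
      obtain ⟨k, m1, m2, m3, m4, m5, j, w, hw, -, rfl⟩ := hgen u
      have sub : ∀ x ∈ ({n, e2, ers, e2qrs, xq, x2q, x2rs, xqrs, xmix} : Set U),
        x ∈ Subgroup.closure ({n, e2, ers, e2qrs, xq, x2q, x2rs, xqrs, xmix} : Set U) :=
        fun x h => Subgroup.subset_closure h
      refine mul_mem ?_ (mul_mem (mul_mem (mul_mem (mul_mem (mul_mem (mul_mem ?_ ?_) ?_) ?_) ?_) ?_) ?_)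
      · rcases hw with rfl | rfl
        · exact one_mem _
        · exact sub _ (by simp)
      all_goals exact zpow_mem (sub _ (by simp)) _
  · choose k m1 m2 m3 m4 m5 j hm using hform
    let ψ : U → (ZMod 2 × ZMod 2 × ZMod 2 × ZMod 2 × ZMod 2) := fun u => ((m1 u : ZMod 2), (m2 u : ZMod 2), (m3 u : ZMod 2), (m4 u : ZMod 2), (m5 u : ZMod 2))
    have hψ : ∀ u k' n1 n2 n3 n4 n5 n6, (φ u = X.P k' n1 n2 n3 n4 n5 n6 ∨ φ u = -X.P k' n1 n2 n3 n4 n5 n6) →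
        ψ u = ((n1 : ZMod 2), (n2 : ZMod 2), (n3 : ZMod 2), (n4 : ZMod 2), (n5 : ZMod 2)) := by
      intro u k' n1 n2 n3 n4 n5 n6 h
      obtain ⟨g1, g2, g3, g4, g5⟩ := X.uniq _ _ _ _ _ _ _ _ _ _ _ _ _ _ _ (hm u) h
      simp only [ψ, g1, g2, g3, g4, g5]
    have hψmul : ∀ u w, ψ (u * w) = ψ u + ψ w := by
      intro u w
      rw [hψ (u * w) (k u + k w) (m1 u + m1 w) (m2 u + m2 w) (m3 u + m3 w) (m4 u + m4 w) (m5 u + m5 w)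
        ((m3 u + 2 * j u) + (m3 w + 2 * j w))]
      · simp [ψ]
      · rw [map_mul, ← X.P_mul]
        rcases hm u with h | h <;> rcases hm w with h' | h' <;> rw [h, h'] <;> simp
    let Ψ : U →* Multiplicative (ZMod 2 × ZMod 2 × ZMod 2 × ZMod 2 × ZMod 2) := MonoidHom.mk' (fun u => Multiplicative.ofAdd (ψ u)) (fun u w => by
      rw [hψmul]; rfl)
    have hΨ : ∀ u, u ∈ Ψ.ker ↔ ψ u = 0 := fun u => Iff.rfl
    have hsurjΨ : Function.Surjective Ψ := by
      intro z
      obtain ⟨z1, z2, z3, z4, z5⟩ := z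
      refine ⟨e2 ^ (0 : ℤ) * xq ^ (z1.val : ℤ) * x2q ^ (z2.val : ℤ) * xmix ^ (z3.val : ℤ) * x2rs ^ (z4.val : ℤ) * xqrs ^ (z5.val : ℤ) * e2qrs ^ (0 : ℤ), ?_⟩
      have := hψ _ _ _ _ _ _ _ _ (Or.inl (hP 0 z1.val z2.val z3.val z4.val z5.val 0))
      change ψ _ = _
      rw [this]
      simp
    have hker : Subgroup.closure {u : U | ∃ K ∈ ({IntermediateField.adjoin ℚ {M.t2}, IntermediateField.adjoin ℚ {M.tq},
      IntermediateField.adjoin ℚ {M.t2 * M.tq}, IntermediateField.adjoin ℚ {M.tr * M.ts},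
      IntermediateField.adjoin ℚ {M.t2 * (M.tr * M.ts)}, IntermediateField.adjoin ℚ {M.tq * (M.tr * M.ts)},
      IntermediateField.adjoin ℚ {M.t2 * (M.tq * (M.tr * M.ts))}} : Set (IntermediateField ℚ L)),
      φ u ∈ K} = Ψ.ker := by
      apply le_antisymm
      · rw [Subgroup.closure_le]
        rintro u ⟨K, hK, hu⟩
        change u ∈ Ψ.ker
        rw [hΨ]
        have two : (2 : ZMod 2) = 0 := rfl
        have g : ∀ ε, IsFundL K ε → ∃ z : ℤ, φ u = ε ^ z ∨ φ u = - ε ^ z := by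
          rintro ε ⟨f1, f2, f3, f4⟩
          obtain ⟨z, hz⟩ := quad_gen K ε f1 f2 f3 f4 _ hu (hmem u).2
          exact ⟨z, by rw [← hz]; rcases abs_choice (φ u) with h | h <;> rw [h] <;> simp⟩
        have z2 : ∀ (x : L) (z : ℤ), (x ^ 2) ^ z = x ^ (2 * z) := fun x z => by rw [zpow_mul]; norm_cast
        rcases hK with rfl | rfl | rfl | rfl | rfl | rfl | rfl
        · obtain ⟨z, hz⟩ := g _ F.f0.2
          rw [hψ u z 0 0 0 0 0 0 (by simpa [XS.P] using hz)]
          simp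
        · obtain ⟨z, hz⟩ := g _ F.f1.2
          rw [hψ u 0 (2 * z) 0 0 0 0 0 (by simpa [XS.P, z2] using hz)]
          simp [two]
        · obtain ⟨z, hz⟩ := g _ F.f2.2
          rw [hψ u 0 0 (2 * z) 0 0 0 0 (by simpa [XS.P, z2] using hz)]
          simp [two]
        · obtain ⟨z, hz⟩ := g _ F.f3.2
          rw [hψ u 0 0 0 (2 * z) 0 0 0 (by simpa [XS.P, z2] using hz)]
          simp [two]
        · obtain ⟨z, hz⟩ := g _ F.f4.2
          rw [hψ u 0 0 0 0 (2 * z) 0 0 (by simpa [XS.P, z2] using hz)]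
          simp [two]
        · obtain ⟨z, hz⟩ := g _ F.f5.2
          rw [hψ u 0 0 0 0 0 (2 * z) 0 (by simpa [XS.P, z2] using hz)]
          simp [two]
        · obtain ⟨z, hz⟩ := g _ F.f6.2
          rw [hψ u 0 0 0 0 0 0 (2 * z) (by simpa [XS.P, z2] using hz)]
          simp
      · intro u hu
        rw [hΨ] at hu
        obtain ⟨k, n1, n2, n3, n4, n5, j, w, hw, hf, hu'⟩ := hgen u
        rw [hψ _ _ _ _ _ _ _ _ hf] at hu
        simp only [Prod.mk_eq_zero, ZMod.intCast_zmod_eq_zero_iff_dvd] at hu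
        obtain ⟨⟨d1, rfl⟩, ⟨d2, rfl⟩, ⟨d3, rfl⟩, ⟨d4, rfl⟩, ⟨d5, rfl⟩⟩ := hu
        rw [hu']
        have xm : xmix ^ 2 = ers * e2qrs := by
          apply hinj
          rw [map_pow, map_mul, hxmix, hers, he2qrs, mul_pow]
        have z2 : ∀ (x : U) (z : ℤ), x ^ (((2 : ℕ) : ℤ) * z) = (x ^ 2) ^ z := fun x z => by rw [zpow_mul]; norm_cast
        simp only [z2]
        rw [xm]
        have sub : ∀ (x : U) (K : IntermediateField ℚ L), φ x ∈ K → K ∈ ({IntermediateField.adjoin ℚ {M.t2}, IntermediateField.adjoin ℚ {M.tq},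
          IntermediateField.adjoin ℚ {M.t2 * M.tq}, IntermediateField.adjoin ℚ {M.tr * M.ts},
          IntermediateField.adjoin ℚ {M.t2 * (M.tr * M.ts)}, IntermediateField.adjoin ℚ {M.tq * (M.tr * M.ts)},
          IntermediateField.adjoin ℚ {M.t2 * (M.tq * (M.tr * M.ts))}} : Set (IntermediateField ℚ L)) →
          x ∈ Subgroup.closure {u : U | ∃ K ∈ ({IntermediateField.adjoin ℚ {M.t2}, IntermediateField.adjoin ℚ {M.tq},
            IntermediateField.adjoin ℚ {M.t2 * M.tq}, IntermediateField.adjoin ℚ {M.tr * M.ts},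
            IntermediateField.adjoin ℚ {M.t2 * (M.tr * M.ts)}, IntermediateField.adjoin ℚ {M.tq * (M.tr * M.ts)},
            IntermediateField.adjoin ℚ {M.t2 * (M.tq * (M.tr * M.ts))}} : Set (IntermediateField ℚ L)),
            φ u ∈ K} := fun x K h h' => Subgroup.subset_closure ⟨K, h', h⟩
        have i6 := sub e2qrs _ (by rw [he2qrs]; exact F.f6.2.1) (by simp)
        refine mul_mem ?_ (mul_mem (mul_mem (mul_mem (mul_mem (mul_mem (mul_mem ?_ ?_) ?_) ?_) ?_) ?_) ?_)
        · rcases hw with rfl | rfl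
          · exact one_mem _
          · exact sub _ (IntermediateField.adjoin ℚ {M.t2}) (by rw [hn]; exact neg_mem (one_mem _)) (by simp)
        · exact zpow_mem (sub _ _ (by rw [he2]; exact F.f0.2.1) (by simp)) _
        · exact zpow_mem (sub _ _ (by rw [map_pow, hxq]; exact F.f1.2.1) (by simp)) _
        · exact zpow_mem (sub _ _ (by rw [map_pow, hx2q]; exact F.f2.2.1) (by simp)) _
        · exact zpow_mem (mul_mem (sub _ _ (by rw [hers]; exact F.f3.2.1) (by simp)) i6) _
        · exact zpow_mem (sub _ _ (by rw [map_pow, hx2rs]; exact F.f4.2.1) (by simp)) _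
        · exact zpow_mem (sub _ _ (by rw [map_pow, hxqrs]; exact F.f5.2.1) (by simp)) _
        · exact zpow_mem i6 _
    rw [hker, Subgroup.index_ker, MonoidHom.range_eq_top.2 hsurjΨ]
    rw [Subgroup.card_top]
    change Nat.card (ZMod 2 × ZMod 2 × ZMod 2 × ZMod 2 × ZMod 2) = _
    simp [Nat.card_prod]
end Transfer


section Final
theorem mem_adj_val {K : IntermediateField ℚ ℝ} (S : Set K) (y : K) :
    y ∈ IntermediateField.adjoin ℚ S ↔ (y : ℝ) ∈ IntermediateField.adjoin ℚ (K.val '' S) := by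
  rw [← IntermediateField.adjoin_map]
  constructor
  · intro h; exact ⟨y, h, rfl⟩
  · rintro ⟨z, hz, hzy⟩
    have : z = y := Subtype.ext hzy
    rwa [← this]

theorem archi (K : IntermediateField ℚ ℝ) : Archimedean K := by
  refine ⟨fun x y hy => ?_⟩
  obtain ⟨n, hn⟩ := Archimedean.arch (x : ℝ) (y := (y : ℝ)) hy
  exact ⟨n, by
    rw [← Subtype.coe_le_coe]
    simpa using hn⟩

theorem isU_val {K : IntermediateField ℚ ℝ} (y : K) : IsU y ↔ IsU (y : ℝ) := by
  have key : ∀ z : K, IsIntegral ℤ z ↔ IsIntegral ℤ (z : ℝ) := fun z =>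
    (isIntegral_algebraMap_iff (R := ℤ) (A := K) (B := ℝ) Subtype.val_injective).symm
  unfold IsU
  rw [key y, key y⁻¹]
  simp

/-- the unit group of `K` sits inside `B` -/
noncomputable def phi (K B : IntermediateField ℚ ℝ) (h : K ≤ B) : (𝓞 K)ˣ →* B where
  toFun u := IntermediateField.inclusion h (algebraMap (𝓞 K) K (u : 𝓞 K))
  map_one' := by simp
  map_mul' := by simp

theorem phi_val (K B : IntermediateField ℚ ℝ) (h : K ≤ B) (u : (𝓞 K)ˣ) : (phi K B h u : ℝ) = unitVal K u := rfl

theorem phi_inj (K B : IntermediateField ℚ ℝ) (h : K ≤ B) : Function.Injective (phi K B h) := by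
  intro u v huv
  have h1 : unitVal K u = unitVal K v := by rw [← phi_val K B h, huv, phi_val]
  exact Units.ext (RingOfIntegers.ext (Subtype.ext h1))

theorem phi_mem (K B : IntermediateField ℚ ℝ) (h : K ≤ B) (u : (𝓞 K)ˣ) :
    (phi K B h u : ℝ) ∈ K ∧ IsU (phi K B h u) := by
  refine ⟨(algebraMap (𝓞 K) K (u : 𝓞 K)).2, ?_⟩
  rw [isU_val, phi_val]
  have h1 : IsU (algebraMap (𝓞 K) K (u : 𝓞 K)) := by
    refine ⟨by simp, RingOfIntegers.isIntegral_coe _, ?_⟩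
    have : (algebraMap (𝓞 K) K (u : 𝓞 K))⁻¹ = algebraMap (𝓞 K) K ((u⁻¹ : (𝓞 K)ˣ) : 𝓞 K) := by
      refine inv_eq_of_mul_eq_one_right ?_
      rw [← map_mul]; simp
    rw [this]; exact RingOfIntegers.isIntegral_coe _
  exact (isU_val _).1 h1

theorem phi_surj (K B : IntermediateField ℚ ℝ) (h : K ≤ B) (y : B) (hy : (y : ℝ) ∈ K) (hU : IsU y) :
    ∃ u, phi K B h u = y := by
  have h1 : IsU (⟨y, hy⟩ : K) := (isU_val _).2 ((isU_val y).1 hU)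
  refine ⟨⟨⟨⟨y, hy⟩, h1.2.1⟩, ⟨(⟨y, hy⟩ : K)⁻¹, h1.2.2⟩, ?_, ?_⟩, ?_⟩
  · apply RingOfIntegers.ext
    exact mul_inv_cancel₀ h1.1
  · apply RingOfIntegers.ext
    exact inv_mul_cancel₀ h1.1
  · apply Subtype.ext
    rfl

theorem phi_neg_one (K B : IntermediateField ℚ ℝ) (h : K ≤ B) : phi K B h (-1) = -1 := by
  apply Subtype.ext
  rw [phi_val]; simp [unitVal]

theorem fund_transfer (K B : IntermediateField ℚ ℝ) (h : K ≤ B) (t : B) (x : ℝ) (ht : (t : ℝ) = x)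
    (u : (𝓞 K)ˣ) (ε : B) (hu : phi K B h u = ε) (hF : IsFundL (IntermediateField.adjoin ℚ {t}) ε) :
    IsFundUnitIn K (Qadj {x}) u := by
  have hm : ∀ y : B, y ∈ IntermediateField.adjoin ℚ {t} ↔ (y : ℝ) ∈ Qadj {x} := by
    intro y
    rw [mem_adj_val, Set.image_singleton, Qadj, ← ht]; rfl
  subst hu
  obtain ⟨f1, f2, f3, f4⟩ := hF
  refine ⟨(hm _).1 f1, f3, fun v hv h1 => f4 (phi K B h v) ((hm _).2 hv) (phi_mem K B h v).2 h1⟩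
end Final

/-- Let q ≡ 7 (mod 8) and r ≡ s ≡ 3 (mod 8) be three distinct primes with
(q/r) = (q/s) = -1 and (s/r) = 1, and write ε_{2qrs} = a + b√(2qrs) (fundamental Pell
solution). Assume 2q(a-1) is not a perfect square. Then the unit group of
K₁ = Q(√2, √q, √(rs)) is generated by
{−1, ε₂, ε_{rs}, ε_{2qrs}, √ε_q, √ε_{2q}, √ε_{2rs}, √ε_{qrs}, √(ε_{rs}ε_{2qrs})},
and the unit index q(K₁) = [E_{K₁} : ∏ E_{kᵢ}] over the seven quadratic subfields
equals 2⁵. -/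
theorem stmt15 (q r s : ℕ) (hq : q.Prime) (hr : r.Prime) (hs : s.Prime)
    (hqr : q ≠ r) (hqs : q ≠ s) (hrs : r ≠ s)
    (hq8 : q % 8 = 7) (hr8 : r % 8 = 3) (hs8 : s % 8 = 3)
    (h1 : @legendreSym r ⟨hr⟩ (q : ℤ) = -1) (h2 : @legendreSym s ⟨hs⟩ (q : ℤ) = -1)
    (h3 : @legendreSym r ⟨hr⟩ (s : ℤ) = 1)
    (a b : ℤ) (ha : 0 < a) (hb : 0 < b)
    (hPell : a ^ 2 - 1 = 2 * q * r * s * b ^ 2)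
    (hfund : ∀ a' b' : ℤ, 0 < a' → 0 < b' → a' ^ 2 - 1 = 2 * q * r * s * b' ^ 2 → a ≤ a')
    (hnsq : ¬ IsSquare (2 * q * (a - 1)))
    (K₁ : IntermediateField ℚ ℝ)
    (hK₁ : K₁ = Qadj {Real.sqrt 2, Real.sqrt q, Real.sqrt (r * s)}) :
    (∃ e2 eq e2q ers e2rs eqrs e2qrs xq x2q x2rs xqrs xmix : (𝓞 K₁)ˣ,
      IsFundUnitIn K₁ (Qadj {Real.sqrt 2}) e2 ∧
      IsFundUnitIn K₁ (Qadj {Real.sqrt q}) eq ∧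
      IsFundUnitIn K₁ (Qadj {Real.sqrt (2 * q)}) e2q ∧
      IsFundUnitIn K₁ (Qadj {Real.sqrt (r * s)}) ers ∧
      IsFundUnitIn K₁ (Qadj {Real.sqrt (2 * (r * s))}) e2rs ∧
      IsFundUnitIn K₁ (Qadj {Real.sqrt (q * (r * s))}) eqrs ∧
      IsFundUnitIn K₁ (Qadj {Real.sqrt (2 * (q * (r * s)))}) e2qrs ∧
      xq ^ 2 = eq ∧ x2q ^ 2 = e2q ∧ x2rs ^ 2 = e2rs ∧ xqrs ^ 2 = eqrs ∧
      xmix ^ 2 = ers * e2qrs ∧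
      (⊤ : Subgroup (𝓞 K₁)ˣ) =
        Subgroup.closure {-1, e2, ers, e2qrs, xq, x2q, x2rs, xqrs, xmix}) ∧
    (subfieldUnits K₁
      {Qadj {Real.sqrt 2}, Qadj {Real.sqrt q}, Qadj {Real.sqrt (2 * q)},
        Qadj {Real.sqrt (r * s)}, Qadj {Real.sqrt (2 * (r * s))},
        Qadj {Real.sqrt (q * (r * s))},
        Qadj {Real.sqrt (2 * (q * (r * s)))}}).index = 2 ^ 5 := by
  have hqF : Fact q.Prime := ⟨hq⟩
  have hrF : Fact r.Prime := ⟨hr⟩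
  have hsF : Fact s.Prime := ⟨hs⟩
  obtain ⟨M, v2, vq, vr, vs⟩ := exists_MQ q r s hq hr hs hqr hqs hrs (by omega) (by omega) (by omega)
  have H : LS q r s := LS_of q r s hq8 hr8 hs8 h1 h2 h3
  obtain ⟨Sq, S2q, Srs, S2rs, Sqrs, S2qrs⟩ := sqfree_facts hq hr hs hqr hqs hrs (by omega) (by omega) (by omega)
  have hq1 := hq.two_le
  have hr1 := hr.two_le
  have hs1 := hs.two_le
  have hrs1 : 2 ≤ r * s := by nlinarith
  have hqrs1 : 2 ≤ q * (r * s) := by nlinarith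
  have nsq : ∀ n : ℕ, 2 ≤ n → Squarefree n → ¬ IsSquare n := by
    rintro n hn hsf ⟨m, rfl⟩
    have := hsf m dvd_rfl
    rw [Nat.isUnit_iff] at this
    subst this; omega
  have hq0 : (0 : ℤ) < q := by exact_mod_cast hq.pos
  have hr0 : (0 : ℤ) < r := by exact_mod_cast hr.pos
  have hs0 : (0 : ℤ) < s := by exact_mod_cast hs.pos
  have hPF : PFund (2 * (q * (r * s))) a b := by
    refine ⟨?_, hb, ?_, ?_⟩
    · have : 0 < 2 * (q : ℤ) * r * s * b ^ 2 := by positivity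
      nlinarith
    · push_cast; linear_combination hPell
    · intro x' y' hx' hy' h
      refine hfund x' y' hx' hy' ?_
      push_cast at h; linear_combination h
  obtain ⟨X, G⟩ := exists_XS M H hq8 hr8 hs8 (nsq _ hq1 Sq) (nsq _ (by omega) S2q) (nsq _ hrs1 Srs)
    (nsq _ (by omega) S2rs) (nsq _ hqrs1 Sqrs) a b hPF hnsq
  have F := G.fund hq hr hs hqr hqs hrs hq8 hr8 hs8
  haveI := archi (bigL q r s)
  have w2q : ((M.t2 * M.tq : bigL q r s) : ℝ) = Real.sqrt (2 * q) := by
    push_cast; rw [v2, vq, Real.sqrt_mul (by positivity)]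
  have wrs : ((M.tr * M.ts : bigL q r s) : ℝ) = Real.sqrt (r * s) := by
    push_cast; rw [vr, vs, Real.sqrt_mul (by positivity)]
  have w2rs : ((M.t2 * (M.tr * M.ts) : bigL q r s) : ℝ) = Real.sqrt (2 * (r * s)) := by
    rw [Real.sqrt_mul (by positivity), ← wrs, ← v2]; rfl
  have wqrs : ((M.tq * (M.tr * M.ts) : bigL q r s) : ℝ) = Real.sqrt (q * (r * s)) := by
    rw [Real.sqrt_mul (by positivity), ← wrs, ← vq]; rfl
  have w2qrs : ((M.t2 * (M.tq * (M.tr * M.ts)) : bigL q r s) : ℝ) = Real.sqrt (2 * (q * (r * s))) := by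
    rw [Real.sqrt_mul (by positivity), ← wqrs, ← v2]; rfl
  have hKL : ∀ y : bigL q r s, y ∈ M.KL ↔ (y : ℝ) ∈ K₁ := by
    intro y
    rw [MQ.KL, mem_adj_val, hK₁, Qadj, Set.image_insert_eq, Set.image_insert_eq, Set.image_singleton]
    rw [show (bigL q r s).val M.t2 = Real.sqrt 2 from v2, show (bigL q r s).val M.tq = Real.sqrt q from vq,
      show (bigL q r s).val (M.tr * M.ts) = Real.sqrt (r * s) from wrs]
  have hle : K₁ ≤ bigL q r s := by
    rw [hK₁, Qadj, IntermediateField.adjoin_le_iff]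
    rintro x (rfl | rfl | rfl)
    · rw [← v2]; exact M.t2.2
    · rw [← vq]; exact M.tq.2
    · rw [← wrs]; exact (M.tr * M.ts).2
  obtain ⟨⟨e2, eq, e2q, ers, e2rs, eqrs, e2qrs, xq, x2q, x2rs, xqrs, xmix, g0, g1, g2, g3, g4, g5, g6,
    k1, k2, k3, k4, k5, k6⟩, hidx⟩ := transfer X G F (phi K₁ (bigL q r s) hle) (phi_inj _ _ hle)
    (fun u => ⟨(hKL _).2 (phi_mem _ _ hle u).1, (phi_mem _ _ hle u).2⟩)
    (fun y hy hU => phi_surj _ _ hle y ((hKL y).1 hy) hU) (-1) (phi_neg_one _ _ hle)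
  refine ⟨⟨e2, eq, e2q, ers, e2rs, eqrs, e2qrs, xq, x2q, x2rs, xqrs, xmix,
    fund_transfer _ _ hle _ _ v2 _ _ g0 F.f0.2,
    fund_transfer _ _ hle _ _ vq _ _ g1 F.f1.2,
    fund_transfer _ _ hle _ _ w2q _ _ g2 F.f2.2,
    fund_transfer _ _ hle _ _ wrs _ _ g3 F.f3.2,
    fund_transfer _ _ hle _ _ w2rs _ _ g4 F.f4.2,
    fund_transfer _ _ hle _ _ wqrs _ _ g5 F.f5.2,
    fund_transfer _ _ hle _ _ w2qrs _ _ g6 F.f6.2, k1, k2, k3, k4, k5, k6⟩, ?_⟩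
  rw [← hidx, subfieldUnits]
  have hm : ∀ (t : bigL q r s) (x : ℝ), (t : ℝ) = x → ∀ y : bigL q r s,
      (y : ℝ) ∈ Qadj {x} ↔ y ∈ IntermediateField.adjoin ℚ {t} := by
    intro t x ht y
    rw [mem_adj_val, Set.image_singleton, Qadj, ← ht]; rfl
  congr 2
  ext u
  simp only [Set.mem_setOf_eq, Set.mem_insert_iff, Set.mem_singleton_iff, exists_eq_or_imp, exists_eq_left]
  rw [← phi_val _ _ hle, hm _ _ v2, hm _ _ vq, hm _ _ w2q, hm _ _ wrs, hm _ _ w2rs, hm _ _ wqrs, hm _ _ w2qrs]
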